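/- arXiv:2604.19177 — 3 statements merged into one kernel-verified Lean document; each statement's English description precedes it below -/
import Mathlib

section
/- (Multiscale factorization.) Fix integers k1, k2 ≥ 1 and T ≥ 1. Let s be a pmf on {1,…,T}, and for each t let a_t be a pmf on {0,…,2^{k1}−1} and b_t a pmf on {0,…,2^{k2}−1}. Let (X_i, Y_i, Z̃_i), i = 1,…,n, be i.i.d. with joint pmf q(x,y,t) = s(t)·a_t(x)·b_t(y) (conditional independence of X and Y given the stratum). Let m = (m(x,y,t)) be any array of nonnegative integers with Σ_{x,y,t} m(x,y,t) = n; set r(x,t) = Σ_y m(x,y,t), c(y,t) = Σ_x m(x,y,t), and m(I,J,t) = Σ_{x∈I, y∈J} m(x,y,t) for dyadic blocks I, J. If the margin event E = { N({x}, full, t) = r(x,t) and N(full, {y}, t) = c(y,t) for all x, y, t } has positive probability, then P( N({x},{y},t) = m(x,y,t) for all x, y, t | E ) = ∏_{t=1}^{T} ∏_{I,J} g₀( m(I^left, J^left, t) | m(I^left, J, t), m(I, J^left, t), m(I, J, t) ), where the inner product ranges over all dyadic blocks I of the X-leaf set of levels 0, …, k1−1 and all dyadic blocks J of the Y-leaf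 set of levels 0, …, k2−1. -/
open MeasureTheory

/-- The level-`l` dyadic block (index `j < 2^l`) of the leaf set `{0, …, 2^k − 1}`:
`{x : j·2^{k−l} ≤ x < (j+1)·2^{k−l}}`. -/
def dblock (k l j : ℕ) : Set ℕ := {x | j * 2 ^ (k - l) ≤ x ∧ x < (j + 1) * 2 ^ (k - l)}

/-- Count `N(I, J, t)` of sample points with `X_i ∈ I`, `Y_i ∈ J`, `Z̃_i = t`. -/
noncomputable def tblCount {K1 K2 T n : ℕ}
    (ω : Fin n → Fin K1 × Fin K2 × Fin T) (I J : Set ℕ) (t : Fin T) : ℕ :=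
  {i : Fin n | ((ω i).1 : ℕ) ∈ I ∧ ((ω i).2.1 : ℕ) ∈ J ∧ (ω i).2.2 = t}.ncard

/-- The (central) hypergeometric pmf `g₀(a | r, c, N) = C(r,a)·C(N−r, c−a)/C(N,c)`. -/
noncomputable def g0 (a r c N : ℕ) : ℝ :=
  (r.choose a * (N - r).choose (c - a) : ℝ) / (N.choose c : ℝ)

instance (k l j x : ℕ) : Decidable (x ∈ dblock k l j) :=
  inferInstanceAs (Decidable (_ ∧ _))

/-- Block sum `m(I, J, t)` of an array `m` over the dyadic blocks `I = B_{l1,j1}`,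
`J = B_{l2,j2}`. -/
def blockSum {k1 k2 T : ℕ} (m : Fin (2 ^ k1) → Fin (2 ^ k2) → Fin T → ℕ)
    (l1 j1 l2 j2 : ℕ) (t : Fin T) : ℕ :=
  ∑ x : Fin (2 ^ k1), ∑ y : Fin (2 ^ k2),
    if (x : ℕ) ∈ dblock k1 l1 j1 ∧ (y : ℕ) ∈ dblock k2 l2 j2 then m x y t else 0

open Finset in
theorem prod_range_two_mul {M : Type*} [CommMonoid M] (f : ℕ → M) (n : ℕ) :
    ∏ j ∈ range (2 * n), f j = ∏ j ∈ range n, (f (2 * j) * f (2 * j + 1)) := by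
  induction n with
  | zero => simp
  | succ n ih =>
    rw [mul_add, mul_one, prod_range_succ, prod_range_succ, ih, prod_range_succ, mul_assoc]

open Finset in
/-- Two-dimensional telescoping of mixed second-order ratios. -/
theorem prod_range_prod_range_ratio {K : Type*} [Field K] (G : ℕ → ℕ → K)
    (hG : ∀ i j, G i j ≠ 0) (p q : ℕ) :
    ∏ i ∈ range p, ∏ j ∈ range q,
        (G (i + 1) j * G i (j + 1) / (G (i + 1) (j + 1) * G i j)) =
      G p 0 * G 0 q / (G 0 0 * G p q) := by
  have row (i : ℕ) : ∏ j ∈ range q,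
      (G (i + 1) j * G i (j + 1) / (G (i + 1) (j + 1) * G i j)) =
      G (i + 1) 0 * G i q / (G i 0 * G (i + 1) q) := by
    induction q with
    | zero =>
      have := hG i 0
      have := hG (i + 1) 0
      simp only [range_zero, prod_empty]
      field_simp
    | succ q ih =>
      have := hG i 0
      have := hG i q
      have := hG (i + 1) q
      have := hG (i + 1) (q + 1)
      rw [prod_range_succ, ih]
      field_simp
  simp_rw [row]
  induction p with
  | zero =>
    have := hG 0 0
    have := hG 0 q
    simp only [range_zero, prod_empty]
    field_simp
  | succ p ih =>
    have := hG 0 0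
    have := hG p 0
    have := hG p q
    have := hG (p + 1) q
    rw [prod_range_succ, ih]
    field_simp

open Nat in
theorem g0_two_by_two (a b c d : ℕ) :
    g0 a (a + b) (a + c) (a + b + (c + d)) =
      ((a + b)! * (c + d)! * ((a + c)! * (b + d)!) : ℝ) /
        (a ! * b ! * (c ! * d !) * (a + b + (c + d))!) := by
  have h : (a + b + (c + d)).choose (a + c) = ((a + c) + (b + d)).choose (a + c) := by
    congr 1; ring
  have h' : a + c + (b + d) = a + b + (c + d) := by ring
  rw [g0, h, Nat.add_sub_cancel_left, Nat.add_sub_cancel_left, Nat.cast_add_choose,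
    Nat.cast_add_choose, Nat.cast_add_choose, h']
  have pos (n : ℕ) : (n ! : ℝ) ≠ 0 := Nat.cast_ne_zero.2 n.factorial_ne_zero
  have := pos a
  have := pos b
  have := pos c
  have := pos d
  have := pos (a + c)
  have := pos (b + d)
  have := pos (a + b + (c + d))
  field_simp

section Blocks

variable {k1 k2 T : ℕ} (m : Fin (2 ^ k1) → Fin (2 ^ k2) → Fin T → ℕ)

theorem mem_dblock_iff_div (k l j x : ℕ) : x ∈ dblock k l j ↔ x / 2 ^ (k - l) = j := by
  have h : 0 < 2 ^ (k - l) := by positivity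
  rw [Nat.div_eq_iff h]
  simp only [dblock, Set.mem_ofPred_eq]
  rw [add_mul]
  omega

/-- Membership in a block is the disjoint alternative of membership in its two children. -/
theorem ite_mem_dblock_eq_add {k l : ℕ} (h : l < k) (j x v : ℕ) :
    (if x ∈ dblock k l j then v else 0) =
      (if x ∈ dblock k (l + 1) (2 * j) then v else 0) +
        (if x ∈ dblock k (l + 1) (2 * j + 1) then v else 0) := by
  simp only [mem_dblock_iff_div]
  have hp : 2 ^ (k - l) = 2 ^ (k - (l + 1)) * 2 := by
    rw [← pow_succ]; congr 1; omega
  rw [hp, ← Nat.div_div_eq_div_mul]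
  split_ifs <;> omega

theorem blockSum_eq_add_left {l1 : ℕ} (h : l1 < k1) (j1 l2 j2 : ℕ) (t : Fin T) :
    blockSum m l1 j1 l2 j2 t =
      blockSum m (l1 + 1) (2 * j1) l2 j2 t + blockSum m (l1 + 1) (2 * j1 + 1) l2 j2 t := by
  simp only [blockSum, ← Finset.sum_add_distrib, ite_and]
  refine Finset.sum_congr rfl fun x _ => Finset.sum_congr rfl fun y _ => ?_
  exact ite_mem_dblock_eq_add h _ _ _

theorem blockSum_eq_add_right {l2 : ℕ} (h : l2 < k2) (l1 j1 j2 : ℕ) (t : Fin T) :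
    blockSum m l1 j1 l2 j2 t =
      blockSum m l1 j1 (l2 + 1) (2 * j2) t + blockSum m l1 j1 (l2 + 1) (2 * j2 + 1) t := by
  simp only [blockSum, ← Finset.sum_add_distrib, and_comm (a := _ ∈ dblock k1 _ _), ite_and]
  refine Finset.sum_congr rfl fun x _ => Finset.sum_congr rfl fun y _ => ?_
  exact ite_mem_dblock_eq_add h _ _ _

theorem mem_dblock_zero {k : ℕ} (x : Fin (2 ^ k)) : (x : ℕ) ∈ dblock k 0 0 := by
  simp [dblock]

theorem mem_dblock_self {k : ℕ} (x z : Fin (2 ^ k)) : (x : ℕ) ∈ dblock k k z ↔ x = z := by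
  simp [mem_dblock_iff_div, Fin.ext_iff]

theorem blockSum_full (t : Fin T) : blockSum m 0 0 0 0 t = ∑ x, ∑ y, m x y t := by
  simp [blockSum, mem_dblock_zero]

theorem blockSum_row (x : Fin (2 ^ k1)) (t : Fin T) :
    blockSum m k1 x 0 0 t = ∑ y, m x y t := by
  simp [blockSum, mem_dblock_zero, mem_dblock_self]

theorem blockSum_col (y : Fin (2 ^ k2)) (t : Fin T) :
    blockSum m 0 0 k2 y t = ∑ x, m x y t := by
  simp [blockSum, mem_dblock_zero, mem_dblock_self]

theorem blockSum_cell (x : Fin (2 ^ k1)) (y : Fin (2 ^ k2)) (t : Fin T) :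
    blockSum m k1 x k2 y t = m x y t := by
  simp [blockSum, mem_dblock_self, ite_and]

/-- Product of the factorials of all block sums at a given pair of levels. -/
noncomputable def blockFactorialProd (t : Fin T) (l1 l2 : ℕ) : ℝ :=
  ∏ j1 ∈ Finset.range (2 ^ l1), ∏ j2 ∈ Finset.range (2 ^ l2),
    ((blockSum m l1 j1 l2 j2 t).factorial : ℝ)

theorem blockFactorialProd_ne_zero (t : Fin T) (l1 l2 : ℕ) :
    blockFactorialProd m t l1 l2 ≠ 0 :=
  Finset.prod_ne_zero_iff.2 fun _ _ => Finset.prod_ne_zero_iff.2 fun _ _ =>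
    Nat.cast_ne_zero.2 (Nat.factorial_ne_zero _)

theorem prod_g0_level {l1 l2 : ℕ} (h1 : l1 < k1) (h2 : l2 < k2) (t : Fin T) :
    ∏ j1 ∈ Finset.range (2 ^ l1), ∏ j2 ∈ Finset.range (2 ^ l2),
        g0 (blockSum m (l1 + 1) (2 * j1) (l2 + 1) (2 * j2) t)
          (blockSum m (l1 + 1) (2 * j1) l2 j2 t)
          (blockSum m l1 j1 (l2 + 1) (2 * j2) t)
          (blockSum m l1 j1 l2 j2 t) =
      blockFactorialProd m t (l1 + 1) l2 * blockFactorialProd m t l1 (l2 + 1) /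
        (blockFactorialProd m t (l1 + 1) (l2 + 1) * blockFactorialProd m t l1 l2) := by
  simp only [blockFactorialProd, pow_succ' 2 l1, pow_succ' 2 l2, prod_range_two_mul,
    ← Finset.prod_mul_distrib, ← Finset.prod_div_distrib]
  refine Finset.prod_congr rfl fun j1 _ => Finset.prod_congr rfl fun j2 _ => ?_
  rw [blockSum_eq_add_left m h1 j1 l2 j2, blockSum_eq_add_left m h1 j1 (l2 + 1) (2 * j2),
    blockSum_eq_add_left m h1 j1 (l2 + 1) (2 * j2 + 1),
    blockSum_eq_add_right m h2 (l1 + 1) (2 * j1), blockSum_eq_add_right m h2 (l1 + 1) (2 * j1 + 1),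
    g0_two_by_two]

open Nat in
theorem prod_g0_eq (t : Fin T) :
    ∏ l1 ∈ Finset.range k1, ∏ j1 ∈ Finset.range (2 ^ l1),
        ∏ l2 ∈ Finset.range k2, ∏ j2 ∈ Finset.range (2 ^ l2),
          g0 (blockSum m (l1 + 1) (2 * j1) (l2 + 1) (2 * j2) t)
            (blockSum m (l1 + 1) (2 * j1) l2 j2 t)
            (blockSum m l1 j1 (l2 + 1) (2 * j2) t)
            (blockSum m l1 j1 l2 j2 t) =
      (∏ x, ((∑ y, m x y t)! : ℝ)) * (∏ y, ((∑ x, m x y t)! : ℝ)) /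
        ((∑ x, ∑ y, m x y t)! * ∏ x, ∏ y, ((m x y t)! : ℝ)) := by
  have hG : ∏ l1 ∈ Finset.range k1, ∏ j1 ∈ Finset.range (2 ^ l1),
        ∏ l2 ∈ Finset.range k2, ∏ j2 ∈ Finset.range (2 ^ l2),
          g0 (blockSum m (l1 + 1) (2 * j1) (l2 + 1) (2 * j2) t)
            (blockSum m (l1 + 1) (2 * j1) l2 j2 t)
            (blockSum m l1 j1 (l2 + 1) (2 * j2) t)
            (blockSum m l1 j1 l2 j2 t) =
      blockFactorialProd m t k1 0 * blockFactorialProd m t 0 k2 /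
        (blockFactorialProd m t 0 0 * blockFactorialProd m t k1 k2) := by
    rw [← prod_range_prod_range_ratio _ (blockFactorialProd_ne_zero m t)]
    refine Finset.prod_congr rfl fun l1 h1 => ?_
    rw [Finset.prod_comm]
    exact Finset.prod_congr rfl fun l2 h2 =>
      prod_g0_level m (Finset.mem_range.1 h1) (Finset.mem_range.1 h2) t
  rw [hG]
  simp only [blockFactorialProd, Finset.prod_range, pow_zero, Fin.val_zero,
    Finset.univ_unique, Finset.prod_singleton, Fin.default_eq_zero,
    blockSum_full, blockSum_row, blockSum_col, blockSum_cell]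

end Blocks

section Counting

open Nat MulAction

theorem exists_comp_perm_eq {α ι : Type*} [Finite α] {f g : α → ι}
    (h : ∀ i, {a | f a = i}.ncard = {a | g a = i}.ncard) :
    ∃ σ : Equiv.Perm α, g ∘ σ = f := by
  have e (i : ι) : Nonempty ({a // f a = i} ≃ {a // g a = i}) := Finite.card_eq.1 (h i)
  refine ⟨(Equiv.sigmaFiberEquiv f).symm.trans
    ((Equiv.sigmaCongrRight fun i => (e i).some).trans (Equiv.sigmaFiberEquiv g)), ?_⟩
  ext a
  exact ((e (f a)).some ⟨a, rfl⟩).2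

/-- The number of functions with prescribed fibre sizes is a multinomial coefficient. -/
theorem ncard_fiber_sizes_mul {α ι : Type*} [Finite α] [Fintype ι] (k : ι → ℕ)
    (hk : ∑ i, k i = Nat.card α) :
    {f : α → ι | ∀ i, {a | f a = i}.ncard = k i}.ncard * ∏ i, (k i)! = (Nat.card α)! := by
  classical
  have := Fintype.ofFinite α
  have hα : Nat.card α = Nat.card (Σ i, Fin (k i)) := by simp [hk]
  obtain ⟨e⟩ := Finite.card_eq.1 hα
  set f₀ : α → ι := fun a => (e a).1 with hf₀
  have hf₀k (i : ι) : {a | f₀ a = i}.ncard = k i := by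
    calc _ = Nat.card {p : Σ i, Fin (k i) // p.1 = i} :=
          Nat.card_congr (e.subtypeEquiv fun a => Iff.rfl)
      _ = Nat.card (Fin (k i)) := Nat.card_congr (Equiv.sigmaSubtype i)
      _ = k i := Nat.card_fin _
  have horb : {f : α → ι | ∀ i, {a | f a = i}.ncard = k i} =
      orbit (Equiv.Perm α)ᵈᵐᵃ f₀ := by
    ext f
    constructor
    · intro hf
      obtain ⟨σ, hσ⟩ := exists_comp_perm_eq (f := f) (g := f₀) fun i => by rw [hf i, hf₀k]
      exact ⟨DomMulAct.mk σ, hσ⟩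
    · rintro ⟨σ, rfl⟩ i
      rw [← hf₀k i]
      exact Nat.card_congr ((DomMulAct.mk.symm σ).subtypeEquiv fun a => Iff.rfl)
  have hstab : Nat.card (stabilizer (Equiv.Perm α)ᵈᵐᵃ f₀) = ∏ i, (k i)! := by
    rw [← Finset.prod_congr rfl fun i _ => congrArg Nat.factorial (hf₀k i),
      ← DomMulAct.stabilizer_ncard]
    exact Nat.card_congr (DomMulAct.mk.symm.subtypeEquiv fun σ => DomMulAct.mem_stabilizer_iff)
  rw [horb, ← hstab, ← Nat.card_coe_set_eq, ← Nat.card_prod,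
    Nat.card_congr (orbitProdStabilizerEquivGroup _ f₀),
    Nat.card_congr DomMulAct.mk.symm, Nat.card_perm]

/-- Functions with prescribed fibre sizes over each fibre of `z` are counted by a product of
multinomial coefficients. -/
theorem ncard_joint_fiber_sizes_mul {α ι τ : Type*} [Finite α] [Fintype ι] [Fintype τ]
    (z : α → τ) (k : ι → τ → ℕ) (hk : ∀ t, {a | z a = t}.ncard = ∑ i, k i t) :
    {f : α → ι | ∀ i t, {a | f a = i ∧ z a = t}.ncard = k i t}.ncard * ∏ t, ∏ i, (k i t)! =
      ∏ t, (∑ i, k i t)! := by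
  let S (t : τ) : Set ({a // z a = t} → ι) := {h | ∀ i, {b | h b = i}.ncard = k i t}
  let e : (α → ι) ≃ ∀ t, {a // z a = t} → ι :=
    ((Equiv.sigmaFiberEquiv z).symm.arrowCongr (Equiv.refl ι)).trans (Equiv.piCurry fun _ _ => ι)
  have he (f : α → ι) :
      (∀ i t, {a | f a = i ∧ z a = t}.ncard = k i t) ↔ ∀ t, e f t ∈ S t := by
    rw [forall_comm]
    refine forall_congr' fun t => forall_congr' fun i => ?_
    have : {a | f a = i ∧ z a = t}.ncard = {b | e f t b = i}.ncard := by
      rw [← Set.ncard_image_of_injective _ Subtype.val_injective]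
      congr 1
      ext a
      constructor
      · rintro ⟨h, rfl⟩
        exact ⟨⟨a, rfl⟩, h, rfl⟩
      · rintro ⟨⟨a, rfl⟩, h, rfl⟩
        exact ⟨h, rfl⟩
    rw [this]
  have hcard : {f : α → ι | ∀ i t, {a | f a = i ∧ z a = t}.ncard = k i t}.ncard =
      ∏ t, (S t).ncard := by
    calc _ = Nat.card {g : ∀ t, {a // z a = t} → ι // ∀ t, g t ∈ S t} :=
          Nat.card_congr (e.subtypeEquiv he)
      _ = Nat.card (∀ t, S t) := Nat.card_congr Equiv.subtypePiEquivPi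
      _ = _ := Nat.card_pi
  rw [hcard, ← Finset.prod_mul_distrib]
  refine Finset.prod_congr rfl fun t _ => ?_
  have ht : Nat.card {a // z a = t} = ∑ i, k i t := hk t
  rw [← ht]
  exact ncard_fiber_sizes_mul (fun i => k i t) ht.symm

/-- Fibre sizes of `z` are the marginals of joint fibre sizes. -/
theorem ncard_fiber_eq_sum {α ι τ : Type*} [Finite α] [Fintype ι] (f : α → ι) (z : α → τ) (t : τ) :
    {a | z a = t}.ncard = ∑ i, {a | f a = i ∧ z a = t}.ncard := by
  calc _ = Nat.card (Σ i, {b : {a // z a = t} // f b = i}) :=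
        Nat.card_congr (Equiv.sigmaFiberEquiv fun b : {a // z a = t} => f b).symm
    _ = ∑ i, Nat.card {b : {a // z a = t} // f b = i} := Nat.card_sigma
    _ = _ := Finset.sum_congr rfl fun i _ => Nat.card_congr
        ((Equiv.subtypeSubtypeEquivSubtypeInter (fun a => z a = t) fun a => f a = i).trans
          (Equiv.subtypeEquivRight fun a => and_comm))

/-- The number of triples of functions with prescribed `(x, t)` and `(y, t)` margins. -/
theorem ncard_margins_mul {α ι κ τ : Type*} [Finite α] [Fintype ι] [Fintype κ] [Fintype τ]
    (r : ι → τ → ℕ) (c : κ → τ → ℕ) (N : τ → ℕ) (hr : ∀ t, ∑ x, r x t = N t)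
    (hc : ∀ t, ∑ y, c y t = N t) (hN : ∑ t, N t = Nat.card α) :
    {ω : α → ι × κ × τ | (∀ x t, {i | (ω i).1 = x ∧ (ω i).2.2 = t}.ncard = r x t) ∧
        ∀ y t, {i | (ω i).2.1 = y ∧ (ω i).2.2 = t}.ncard = c y t}.ncard *
      ((∏ t, ∏ x, (r x t)!) * ∏ t, ∏ y, (c y t)!) = (Nat.card α)! * ∏ t, (N t)! := by
  let Z : Set (α → τ) := {z | ∀ t, {a | z a = t}.ncard = N t}
  let F (z : α → τ) : Set (α → ι) := {f | ∀ x t, {a | f a = x ∧ z a = t}.ncard = r x t}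
  let G (z : α → τ) : Set (α → κ) := {g | ∀ y t, {a | g a = y ∧ z a = t}.ncard = c y t}
  have hcard : {ω : α → ι × κ × τ |
      (∀ x t, {i | (ω i).1 = x ∧ (ω i).2.2 = t}.ncard = r x t) ∧
        ∀ y t, {i | (ω i).2.1 = y ∧ (ω i).2.2 = t}.ncard = c y t}.ncard =
      Nat.card (Σ z : Z, F z × G z) := by
    refine Nat.card_congr
      { toFun := fun ω => ⟨⟨fun a => (ω.1 a).2.2, fun t => ?_⟩,
          ⟨fun a => (ω.1 a).1, ω.2.1⟩, ⟨fun a => (ω.1 a).2.1, ω.2.2⟩⟩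
        invFun := fun p => ⟨fun a => (p.2.1.1 a, p.2.2.1 a, p.1.1 a), p.2.1.2, p.2.2.2⟩
        left_inv := fun ω => rfl
        right_inv := fun p => rfl }
    rw [ncard_fiber_eq_sum (fun a => (ω.1 a).1), ← hr]
    exact Finset.sum_congr rfl fun x _ => ω.2.1 x t
  have := Fintype.ofFinite Z
  rw [hcard, Nat.card_sigma, Finset.sum_mul]
  have hterm (z : Z) : Nat.card (F z × G z) * ((∏ t, ∏ x, (r x t)!) * ∏ t, ∏ y, (c y t)!) =
      (∏ t, (N t)!) * ∏ t, (N t)! := by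
    have h1 := ncard_joint_fiber_sizes_mul z.1 r fun t => (z.2 t).trans (hr t).symm
    have h2 := ncard_joint_fiber_sizes_mul z.1 c fun t => (z.2 t).trans (hc t).symm
    simp only [hr] at h1
    simp only [hc] at h2
    rw [Nat.card_prod, mul_mul_mul_comm]
    exact congrArg₂ (· * ·) h1 h2
  rw [Finset.sum_congr rfl fun z _ => hterm z, Finset.sum_const, smul_eq_mul, ← mul_assoc,
    Finset.card_univ, ← Nat.card_eq_fintype_card]
  exact congrArg (· * _) (ncard_fiber_sizes_mul N hN)

end Counting

section Probability

open MeasureTheory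

theorem measure_eq_ncard_mul {Ω : Type*} [Finite Ω] [MeasurableSpace Ω]
    [MeasurableSingletonClass Ω] (μ : Measure Ω) {S : Set Ω} {w : ENNReal}
    (h : ∀ ω ∈ S, μ {ω} = w) : μ S = S.ncard * w := by
  have hS := Set.toFinite S
  rw [Set.ncard_eq_toFinset_card S hS, ← nsmul_eq_mul, ← Finset.sum_const]
  conv_lhs => rw [← hS.coe_toFinset, ← sum_measure_singleton]
  exact Finset.sum_congr rfl fun ω hω => h ω (hS.mem_toFinset.1 hω)

/-- A measure with constant point masses on `E` is conditionally uniform given `E`. -/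
theorem cond_eq_ncard_div_ncard {Ω : Type*} [Finite Ω] [MeasurableSpace Ω]
    [MeasurableSingletonClass Ω] (μ : Measure Ω) [IsFiniteMeasure μ] {A E : Set Ω} {w : ENNReal}
    (h : ∀ ω ∈ E, μ {ω} = w) (hAE : A ⊆ E) (hE : μ E ≠ 0) :
    ProbabilityTheory.cond μ E A = ENNReal.ofReal (A.ncard / E.ncard) := by
  have hμE := measure_eq_ncard_mul μ h
  have hE0 : E.ncard ≠ 0 := by
    rintro h0
    exact hE (by rw [hμE, h0]; simp)
  have hw0 : w ≠ 0 := by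
    rintro rfl
    exact hE (by rw [hμE, mul_zero])
  have hwt : w ≠ ⊤ := by
    obtain ⟨ω, hω⟩ := Set.nonempty_of_ncard_ne_zero hE0
    exact h ω hω ▸ measure_ne_top μ _
  rw [ProbabilityTheory.cond_apply (Set.toFinite E).measurableSet,
    Set.inter_eq_self_of_subset_right hAE, hμE, measure_eq_ncard_mul μ fun ω hω => h ω (hAE hω),
    mul_comm, ← div_eq_mul_inv, ENNReal.mul_div_mul_right _ _ hw0 hwt,
    ENNReal.ofReal_div_of_pos (by positivity), ENNReal.ofReal_natCast, ENNReal.ofReal_natCast]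

theorem prod_comp_eq_prod_pow_ncard {α ι M : Type*} [Fintype α] [Fintype ι] [CommMonoid M]
    (u : ι → M) (f : α → ι) : ∏ a, u (f a) = ∏ i, u i ^ {a | f a = i}.ncard := by
  classical
  rw [← Fintype.prod_fiberwise' f u]
  refine Finset.prod_congr rfl fun i _ => ?_
  rw [Finset.prod_const, Finset.card_univ, ← Nat.card_eq_fintype_card]
  rfl

/-- An i.i.d. sample under conditional independence has point probabilities depending only on the
`(x, t)` and `(y, t)` margins. -/
theorem pi_singleton_eq_of_margins {α ι κ τ : Type*} [Fintype α] [Fintype ι] [Fintype κ]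
    [Fintype τ] [MeasurableSpace (ι × κ × τ)] (P : Measure (ι × κ × τ)) [SigmaFinite P]
    (u : ι × τ → ENNReal) (v : κ × τ → ENNReal)
    (hP : ∀ x y t, P {(x, y, t)} = u (x, t) * v (y, t)) (r : ι → τ → ℕ) (c : κ → τ → ℕ)
    (ω : α → ι × κ × τ) (hr : ∀ x t, {i | (ω i).1 = x ∧ (ω i).2.2 = t}.ncard = r x t)
    (hc : ∀ y t, {i | (ω i).2.1 = y ∧ (ω i).2.2 = t}.ncard = c y t) :
    (Measure.pi fun _ : α => P) {ω} =
      (∏ p : ι × τ, u p ^ r p.1 p.2) * ∏ p : κ × τ, v p ^ c p.1 p.2 := by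
  rw [Measure.pi_singleton, Finset.prod_congr rfl fun i _ => hP (ω i).1 (ω i).2.1 (ω i).2.2,
    Finset.prod_mul_distrib, prod_comp_eq_prod_pow_ncard u fun i => ((ω i).1, (ω i).2.2),
    prod_comp_eq_prod_pow_ncard v fun i => ((ω i).2.1, (ω i).2.2)]
  simp only [Prod.ext_iff, hr, hc]

end Probability

/-- multiscale factorization: for i.i.d. samples from a conditionally
independent law `q(x,y,t) = s(t)·a_t(x)·b_t(y)` on `{0,…,2^{k1}−1}×{0,…,2^{k2}−1}×{1,…,T}`,
conditionally on all stratum-specific row and column margins, the probability of observing a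
given three-way table `m` is the product over all strata and all coarse-to-fine dyadic windows
of hypergeometric probabilities `g₀(m(I^left,J^left,t) | m(I^left,J,t), m(I,J^left,t), m(I,J,t))`. -/
theorem multiscale_factorization
    (k1 k2 T n : ℕ) (hk1 : 1 ≤ k1) (hk2 : 1 ≤ k2) (hT : 1 ≤ T)
    (s : Fin T → ℝ) (hs0 : ∀ t, 0 ≤ s t) (hs1 : ∑ t, s t = 1)
    (a : Fin T → Fin (2 ^ k1) → ℝ) (ha0 : ∀ t x, 0 ≤ a t x) (ha1 : ∀ t, ∑ x, a t x = 1)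
    (b : Fin T → Fin (2 ^ k2) → ℝ) (hb0 : ∀ t y, 0 ≤ b t y) (hb1 : ∀ t, ∑ y, b t y = 1)
    (P : Measure (Fin (2 ^ k1) × Fin (2 ^ k2) × Fin T)) [IsProbabilityMeasure P]
    (hP : ∀ x y t, P {(x, y, t)} = ENNReal.ofReal (s t * a t x * b t y))
    (m : Fin (2 ^ k1) → Fin (2 ^ k2) → Fin T → ℕ)
    (hm : ∑ x, ∑ y, ∑ t, m x y t = n)
    (hE : (Measure.pi fun _ : Fin n => P)
        {ω | (∀ x t, {i : Fin n | (ω i).1 = x ∧ (ω i).2.2 = t}.ncard = ∑ y, m x y t) ∧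
             ∀ y t, {i : Fin n | (ω i).2.1 = y ∧ (ω i).2.2 = t}.ncard = ∑ x, m x y t} ≠ 0) :
    ProbabilityTheory.cond (Measure.pi fun _ : Fin n => P)
        {ω | (∀ x t, {i : Fin n | (ω i).1 = x ∧ (ω i).2.2 = t}.ncard = ∑ y, m x y t) ∧
             ∀ y t, {i : Fin n | (ω i).2.1 = y ∧ (ω i).2.2 = t}.ncard = ∑ x, m x y t}
        {ω | ∀ x y t, {i : Fin n | ω i = (x, y, t)}.ncard = m x y t} =
      ENNReal.ofReal (∏ t : Fin T, ∏ l1 ∈ Finset.range k1, ∏ j1 ∈ Finset.range (2 ^ l1),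
        ∏ l2 ∈ Finset.range k2, ∏ j2 ∈ Finset.range (2 ^ l2),
          g0 (blockSum m (l1 + 1) (2 * j1) (l2 + 1) (2 * j2) t)
            (blockSum m (l1 + 1) (2 * j1) l2 j2 t)
            (blockSum m l1 j1 (l2 + 1) (2 * j2) t)
            (blockSum m l1 j1 l2 j2 t)) := by
  set r : Fin (2 ^ k1) → Fin T → ℕ := fun x t => ∑ y, m x y t
  set c : Fin (2 ^ k2) → Fin T → ℕ := fun y t => ∑ x, m x y t
  set N : Fin T → ℕ := fun t => ∑ x, ∑ y, m x y t
  have hc (t : Fin T) : ∑ y, c y t = N t := Finset.sum_comm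
  have hN : ∑ t, N t = Nat.card (Fin n) := by
    rw [Nat.card_fin, ← hm]
    exact Finset.sum_comm.trans (Finset.sum_congr rfl fun x _ => Finset.sum_comm)
  have hcells := ncard_fiber_sizes_mul (α := Fin n)
    (fun p : Fin (2 ^ k1) × Fin (2 ^ k2) × Fin T => m p.1 p.2.1 p.2.2)
    (by simpa only [Fintype.sum_prod_type, Nat.card_fin] using hm)
  have hmargins := ncard_margins_mul (α := Fin n) r c N (fun _ => rfl) hc hN
  have hM : ∏ p : Fin (2 ^ k1) × Fin (2 ^ k2) × Fin T, (m p.1 p.2.1 p.2.2).factorial =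
      ∏ t, ∏ x, ∏ y, (m x y t).factorial := by
    simp only [Fintype.prod_prod_type]
    exact (Finset.prod_congr rfl fun x _ => Finset.prod_comm).trans Finset.prod_comm
  rw [hM] at hcells
  simp only [Prod.forall] at hcells
  rw [cond_eq_ncard_div_ncard _ (fun ω hω => pi_singleton_eq_of_margins P
    (fun p => ENNReal.ofReal (s p.2 * a p.2 p.1)) (fun p => ENNReal.ofReal (b p.2 p.1))
    (fun x y t => by rw [hP, ENNReal.ofReal_mul (mul_nonneg (hs0 t) (ha0 t x))])
    r c ω hω.1 hω.2) ?_ hE]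
  · congr 1
    simp only [prod_g0_eq, Finset.prod_div_distrib, Finset.prod_mul_distrib]
    rw [div_eq_div_iff]
    · have h := congrArg (Nat.cast (R := ℝ)) hcells
      have h' := congrArg (Nat.cast (R := ℝ)) hmargins
      push_cast at h h'
      linear_combination (∏ t, ((N t).factorial : ℝ)) * h - h'
    · refine Nat.cast_ne_zero.2 (left_ne_zero_of_mul (hmargins.trans_ne (mul_ne_zero ?_ ?_)))
      · exact Nat.factorial_ne_zero _
      · exact Finset.prod_ne_zero_iff.2 fun t _ => Nat.factorial_ne_zero _
    · norm_cast
      simp [Finset.prod_ne_zero_iff, Nat.factorial_ne_zero]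
  · intro ω hω
    constructor
    · intro x t
      have h := ncard_fiber_eq_sum (fun i => (ω i).2.1) (fun i => ((ω i).1, (ω i).2.2)) (x, t)
      simp only [Prod.ext_iff] at h
      rw [h]
      refine Finset.sum_congr rfl fun y _ => ?_
      rw [← hω x y t]
      congr 1
      ext i
      simp only [Set.mem_ofPred_eq, Prod.ext_iff]
      tauto
    · intro y t
      have h := ncard_fiber_eq_sum (fun i => (ω i).1) (fun i => ((ω i).2.1, (ω i).2.2)) (y, t)
      simp only [Prod.ext_iff] at h
      rw [h]
      refine Finset.sum_congr rfl fun x _ => ?_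
      rw [← hω x y t]
      congr 1
      ext i
      simp only [Set.mem_ofPred_eq, Prod.ext_iff]
end

section
/- (Exact conditional independence of same-resolution windows.) Fix integers k1, k2 ≥ 1 and T ≥ 1. Let s be a pmf on {1,…,T}, and for each t let a_t be a pmf on {0,…,2^{k1}−1} and b_t a pmf on {0,…,2^{k2}−1}; let (X_i, Y_i, Z̃_i), i = 1,…,n, be i.i.d. with joint pmf q(x,y,t) = s(t)·a_t(x)·b_t(y). Fix 0 ≤ k ≤ k1 + k2 − 2 and let 𝔊_k be the σ-algebra generated by all counts N(I,J,t) where I, J are dyadic blocks with level(I) + level(J) = k + 1 and t ∈ {1,…,T}. Call (I,J) a resolution-k window if level(I) + level(J) = k with level(I) ≤ k1−1 and level(J) ≤ k2−1. For each resolution-k window (I,J), let E(I,J) be an event determined by the window table (N(I',J',t)) for I' ∈ {I^left, I^right}, J' ∈ {J^left, J^right}, t ∈ {1,…,T}. Then almost surely P( ∩_{(I,J)} E(I,J) | 𝔊_k ) = ∏_{(I,J)} P( E(I,J) | 𝔊_k ), where intersection and product range over all resolution-k windows; moreover, for each window, P(E(I,J) | 𝔊_k) coincides almost surely with the conditional probability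 given only its own margin counts (N(I^left, J, t), N(I, J^left, t), N(I, J, t))_{t ≤ T}. -/
open MeasureTheory

/-- The resolution-`k` windows: triples `w = (l1, j1, j2)` encoding the window `I × J` with
`I = B_{l1, j1}`, `J = B_{l2, j2}`, `l2 = k − l1`, `level(I) ≤ k1 − 1`, `level(J) ≤ k2 − 1`. -/
def resWindows (k1 k2 k : ℕ) : Finset (ℕ × ℕ × ℕ) :=
  (Finset.range (k + 1) ×ˢ Finset.range (2 ^ k) ×ˢ Finset.range (2 ^ k)).filter
    fun w => w.1 + 1 ≤ k1 ∧ (k - w.1) + 1 ≤ k2 ∧ w.2.1 < 2 ^ w.1 ∧ w.2.2 < 2 ^ (k - w.1)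

/-- The `2 × 2 × T` window table of the window `w = (l1, j1, j2)` of resolution `k`:
entry `(u, v, t)` is `N(I', J', t)` where `I'` is the left (`u = 0`) or right (`u = 1`) child
of `I = B_{l1,j1}` and `J'` is the left/right child of `J = B_{k−l1, j2}`. -/
noncomputable def windowTable (k1 k2 : ℕ) {T n : ℕ} (k : ℕ) (w : ℕ × ℕ × ℕ)
    (ω : Fin n → Fin (2 ^ k1) × Fin (2 ^ k2) × Fin T) :
    Fin 2 → Fin 2 → Fin T → ℕ :=
  fun u v t =>
    tblCount ω (dblock k1 (w.1 + 1) (2 * w.2.1 + (u : ℕ)))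
      (dblock k2 ((k - w.1) + 1) (2 * w.2.2 + (v : ℕ))) t

/-- All counts `N(I, J, t)` over dyadic blocks `I`, `J` of levels summing to `k + 1`
(encoded as a single function; entries outside the valid index range are `0`).
The σ-algebra `𝔊_k` is the one generated (by `comap`) by this map. -/
noncomputable def resCounts (k1 k2 : ℕ) {T n : ℕ} (k : ℕ)
    (ω : Fin n → Fin (2 ^ k1) × Fin (2 ^ k2) × Fin T) :
    ℕ × ℕ × ℕ × ℕ × Fin T → ℕ :=
  fun q =>
    if q.1 + q.2.1 = k + 1 ∧ q.1 ≤ k1 ∧ q.2.1 ≤ k2 ∧ q.2.2.1 < 2 ^ q.1 ∧ q.2.2.2.1 < 2 ^ q.2.1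
    then tblCount ω (dblock k1 q.1 q.2.2.1) (dblock k2 q.2.1 q.2.2.2.1) q.2.2.2.2
    else 0

/-- The stratum-specific margin counts `(N(I^left, J, t), N(I, J^left, t), N(I, J, t))_{t ≤ T}`
of the window `w = (l1, j1, j2)` of resolution `k`. -/
noncomputable def windowMargins (k1 k2 : ℕ) {T n : ℕ} (k : ℕ) (w : ℕ × ℕ × ℕ)
    (ω : Fin n → Fin (2 ^ k1) × Fin (2 ^ k2) × Fin T) : Fin T → ℕ × ℕ × ℕ :=
  fun t =>
    (tblCount ω (dblock k1 (w.1 + 1) (2 * w.2.1)) (dblock k2 (k - w.1) w.2.2) t,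
     tblCount ω (dblock k1 w.1 w.2.1) (dblock k2 ((k - w.1) + 1) (2 * w.2.2)) t,
     tblCount ω (dblock k1 w.1 w.2.1) (dblock k2 (k - w.1) w.2.2) t)

theorem mem_dblock_iff {k l j x : ℕ} : x ∈ dblock k l j ↔ x / 2 ^ (k - l) = j := by
  have h : 0 < 2 ^ (k - l) := by positivity
  rw [Nat.div_eq_iff h, dblock, Set.mem_ofPred_eq, add_mul, one_mul]
  omega

theorem mem_dblock_congr_of_le {k l l' j x y : ℕ} (h : l' ≤ l) (hx : x ∈ dblock k l j)
    (hy : y ∈ dblock k l j) (j' : ℕ) : x ∈ dblock k l' j' ↔ y ∈ dblock k l' j' := by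
  rw [mem_dblock_iff] at hx hy
  have e : 2 ^ (k - l') = 2 ^ (k - l) * 2 ^ (k - l' - (k - l)) := by
    rw [← pow_add]; congr 1; omega
  rw [mem_dblock_iff, mem_dblock_iff, e, ← Nat.div_div_eq_div_mul, ← Nat.div_div_eq_div_mul,
    hx, hy]

theorem mem_dblock_iff_children {k l j x : ℕ} (h : l + 1 ≤ k) :
    x ∈ dblock k l j ↔ x ∈ dblock k (l + 1) (2 * j) ∨ x ∈ dblock k (l + 1) (2 * j + 1) := by
  have e : 2 ^ (k - l) = 2 ^ (k - (l + 1)) * 2 := by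
    rw [← pow_succ]; congr 1; omega
  rw [mem_dblock_iff, mem_dblock_iff, mem_dblock_iff, e, ← Nat.div_div_eq_div_mul]
  omega

theorem eq_of_mem_dblock {k l j j' x : ℕ} (h : x ∈ dblock k l j) (h' : x ∈ dblock k l j') :
    j = j' := by
  rw [mem_dblock_iff] at h h'
  exact h.symm.trans h'

theorem mem_dblock_of_mem_child {κ l c x : ℕ} {u : Fin 2} (hl : l + 1 ≤ κ)
    (h : x ∈ dblock κ (l + 1) (2 * c + (u : ℕ))) : x ∈ dblock κ l c := by
  refine (mem_dblock_iff_children hl).2 ?_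
  fin_cases u
  · exact .inl h
  · exact .inr h

theorem not_mem_dblock_succ {κ l c x : ℕ} (h : x ∈ dblock κ l (2 * c)) :
    x ∉ dblock κ l (2 * c + 1) := fun h' => by
  have := eq_of_mem_dblock h h'
  omega

section Swap

variable {K1 K2 T n : ℕ}

/-- Exchange the `Y`-coordinates of the sample points `i` and `j`. -/
def swapY (i j : Fin n) (ω : Fin n → Fin K1 × Fin K2 × Fin T) :
    Fin n → Fin K1 × Fin K2 × Fin T :=
  fun m => ((ω m).1, (ω (Equiv.swap i j m)).2.1, (ω m).2.2)

theorem swapY_involutive (i j : Fin n) :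
    Function.Involutive (swapY (K1 := K1) (K2 := K2) (T := T) i j) := by
  intro ω
  funext m
  simp [swapY]

theorem swap_apply_congr {α : Type*} {f : Fin n → α} {i j : Fin n} (h : f i = f j) (m : Fin n) :
    f (Equiv.swap i j m) = f m := by
  by_cases hi : m = i
  · simp [hi, h]
  by_cases hj : m = j
  · simp [hj, h]
  · rw [Equiv.swap_apply_of_ne_of_ne hi hj]

theorem tblCount_swapY_of_iff_right {ω : Fin n → Fin K1 × Fin K2 × Fin T} {i j : Fin n}
    {J : Set ℕ} (h : ((ω i).2.1 : ℕ) ∈ J ↔ ((ω j).2.1 : ℕ) ∈ J) (I : Set ℕ) (t : Fin T) :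
    tblCount (swapY i j ω) I J t = tblCount ω I J t := by
  have h' := swap_apply_congr (f := fun m => ((ω m).2.1 : ℕ) ∈ J) (propext h)
  simp only [tblCount, swapY, h']

theorem tblCount_swapY_of_iff_left {ω : Fin n → Fin K1 × Fin K2 × Fin T} {i j : Fin n}
    (ht : (ω i).2.2 = (ω j).2.2)
    {I : Set ℕ} (h : ((ω i).1 : ℕ) ∈ I ↔ ((ω j).1 : ℕ) ∈ I) (J : Set ℕ) (t : Fin T) :
    tblCount (swapY i j ω) I J t = tblCount ω I J t := by
  have h' := swap_apply_congr (f := fun m => ((ω m).1 : ℕ) ∈ I) (propext h)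
  have ht' := swap_apply_congr (f := fun m => (ω m).2.2) ht
  simp only [tblCount, swapY]
  rw [← Set.ncard_preimage_of_injective_subset_range (Equiv.swap i j).injective (by simp)]
  congr 1
  ext m
  simp only [Set.mem_preimage, Set.mem_ofPred_eq, Equiv.swap_apply_self, h', ht']

theorem tblCount_union_left (ω : Fin n → Fin K1 × Fin K2 × Fin T) {I I₀ I₁ : Set ℕ}
    (hI : ∀ x, x ∈ I ↔ x ∈ I₀ ∨ x ∈ I₁) (hd : ∀ x ∈ I₀, x ∉ I₁) (J : Set ℕ) (t : Fin T) :
    tblCount ω I J t = tblCount ω I₀ J t + tblCount ω I₁ J t := by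
  rw [tblCount, tblCount, tblCount, ← Set.ncard_union_eq]
  · congr 1
    ext m
    simp only [Set.mem_ofPred_eq, Set.mem_union, hI]
    tauto
  · exact Set.disjoint_left.2 fun m h h' => hd _ h.1 h'.1

theorem tblCount_union_right (ω : Fin n → Fin K1 × Fin K2 × Fin T) {J J₀ J₁ : Set ℕ}
    (hJ : ∀ x, x ∈ J ↔ x ∈ J₀ ∨ x ∈ J₁) (hd : ∀ x ∈ J₀, x ∉ J₁) (I : Set ℕ) (t : Fin T) :
    tblCount ω I J t = tblCount ω I J₀ t + tblCount ω I J₁ t := by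
  rw [tblCount, tblCount, tblCount, ← Set.ncard_union_eq]
  · congr 1
    ext m
    simp only [Set.mem_ofPred_eq, Set.mem_union, hJ]
    tauto
  · exact Set.disjoint_left.2 fun m h h' => hd _ h.2.1 h'.2.1

theorem tblCount_swapY_add_one {ω : Fin n → Fin K1 × Fin K2 × Fin T} {i j : Fin n} {I J : Set ℕ}
    (hi : ((ω i).1 : ℕ) ∈ I ∧ ((ω i).2.1 : ℕ) ∈ J)
    (hj : ((ω j).1 : ℕ) ∉ I ∧ ((ω j).2.1 : ℕ) ∉ J) :
    tblCount (swapY i j ω) I J (ω i).2.2 + 1 = tblCount ω I J (ω i).2.2 := by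
  have hmem : i ∈ {m : Fin n | ((ω m).1 : ℕ) ∈ I ∧ ((ω m).2.1 : ℕ) ∈ J ∧
      (ω m).2.2 = (ω i).2.2} := ⟨hi.1, hi.2, rfl⟩
  rw [tblCount, tblCount, ← Set.ncard_sdiff_singleton_add_one hmem]
  congr 2
  ext m
  simp only [swapY, Set.mem_ofPred_eq, Set.mem_sdiff, Set.mem_singleton_iff]
  by_cases hm : m = i
  · subst hm; simp [hj.2]
  by_cases hm' : m = j
  · subst hm'; simp [hj.1]
  · simp [Equiv.swap_apply_of_ne_of_ne hm hm', hm]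

theorem tblCount_swapY_of_ne {ω : Fin n → Fin K1 × Fin K2 × Fin T} {i j : Fin n}
    (ht : (ω i).2.2 = (ω j).2.2) {t : Fin T} (h : t ≠ (ω i).2.2) (I J : Set ℕ) :
    tblCount (swapY i j ω) I J t = tblCount ω I J t := by
  rw [tblCount, tblCount]
  congr 1
  ext m
  simp only [swapY, Set.mem_ofPred_eq]
  by_cases hm : m = i
  · subst hm; simp [h.symm]
  by_cases hm' : m = j
  · subst hm'; simp [← ht, h.symm]
  · simp [Equiv.swap_apply_of_ne_of_ne hm hm']

theorem prod_swapY {R : Type*} [CommMonoid R] {ω : Fin n → Fin K1 × Fin K2 × Fin T} {i j : Fin n}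
    (ht : (ω i).2.2 = (ω j).2.2) (f : Fin T → Fin K1 → R) (g : Fin T → Fin K2 → R) :
    ∏ m, (f (swapY i j ω m).2.2 (swapY i j ω m).1 * g (swapY i j ω m).2.2 (swapY i j ω m).2.1)
      = ∏ m, (f (ω m).2.2 (ω m).1 * g (ω m).2.2 (ω m).2.1) := by
  have ht' := swap_apply_congr (f := fun m => (ω m).2.2) ht
  rw [Finset.prod_mul_distrib, Finset.prod_mul_distrib]
  congr 1
  rw [← Equiv.prod_comp (Equiv.swap i j)]
  simp [swapY, ht']

end Swap

section Window

variable {k1 k2 T n k : ℕ} {w : ℕ × ℕ × ℕ}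

/-- The sample points `i` and `j` lie in the window `w` and in the same stratum. -/
def SameWindow (k1 k2 k : ℕ) (w : ℕ × ℕ × ℕ)
    (ω : Fin n → Fin (2 ^ k1) × Fin (2 ^ k2) × Fin T) (i j : Fin n) : Prop :=
  (((ω i).1 : ℕ) ∈ dblock k1 w.1 w.2.1 ∧ ((ω i).2.1 : ℕ) ∈ dblock k2 (k - w.1) w.2.2) ∧
  (((ω j).1 : ℕ) ∈ dblock k1 w.1 w.2.1 ∧ ((ω j).2.1 : ℕ) ∈ dblock k2 (k - w.1) w.2.2) ∧
  (ω i).2.2 = (ω j).2.2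

/-- `φ` is unchanged when two points of the window `w` in the same stratum exchange their
`Y`-coordinates. -/
def WindowInvariant (k1 k2 k : ℕ) (w : ℕ × ℕ × ℕ) {γ : Type*}
    (φ : (Fin n → Fin (2 ^ k1) × Fin (2 ^ k2) × Fin T) → γ) : Prop :=
  ∀ ω i j, SameWindow k1 k2 k w ω i j → φ (swapY i j ω) = φ ω

theorem WindowInvariant.comp {γ δ : Type*}
    {φ : (Fin n → Fin (2 ^ k1) × Fin (2 ^ k2) × Fin T) → γ}
    (h : WindowInvariant k1 k2 k w φ) (g : γ → δ) :
    WindowInvariant k1 k2 k w (fun ω => g (φ ω)) :=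
  fun ω i j hij => congrArg g (h ω i j hij)

theorem windowInvariant_tblCount {l₁ l₂ : ℕ} (h : l₁ ≤ w.1 ∨ l₂ ≤ k - w.1) (j₁ j₂ : ℕ)
    (t : Fin T) : WindowInvariant (n := n) k1 k2 k w
      fun ω => tblCount ω (dblock k1 l₁ j₁) (dblock k2 l₂ j₂) t := by
  intro ω i j hij
  rcases h with h | h
  · exact tblCount_swapY_of_iff_left hij.2.2
      (mem_dblock_congr_of_le h hij.1.1 hij.2.1.1 j₁) _ _
  · exact tblCount_swapY_of_iff_right (mem_dblock_congr_of_le h hij.1.2 hij.2.1.2 j₂) _ _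

theorem le_and_le_of_mem_resWindows (hw : w ∈ resWindows k1 k2 k) :
    w.1 ≤ k ∧ w.1 + 1 ≤ k1 ∧ k - w.1 + 1 ≤ k2 ∧ w.2.1 < 2 ^ w.1 ∧ w.2.2 < 2 ^ (k - w.1) := by
  simp only [resWindows, Finset.mem_filter, Finset.mem_product, Finset.mem_range] at hw
  exact ⟨by omega, hw.2⟩

theorem windowInvariant_resCounts :
    WindowInvariant k1 k2 k w (resCounts (T := T) (n := n) k1 k2 k) := by
  intro ω i j hij
  funext q
  simp only [resCounts]
  split_ifs with h
  · exact windowInvariant_tblCount (by omega) _ _ _ ω i j hij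
  · rfl

theorem windowInvariant_windowMargins :
    WindowInvariant k1 k2 k w (windowMargins (T := T) (n := n) k1 k2 k w) := by
  intro ω i j hij
  funext t
  simp only [windowMargins]
  exact Prod.ext (windowInvariant_tblCount (.inr le_rfl) _ _ _ ω i j hij)
    (Prod.ext (windowInvariant_tblCount (.inl le_rfl) _ _ _ ω i j hij)
      (windowInvariant_tblCount (.inl le_rfl) _ _ _ ω i j hij))

theorem windowInvariant_windowTable {w' : ℕ × ℕ × ℕ} (hw : w ∈ resWindows k1 k2 k)
    (hw' : w' ∈ resWindows k1 k2 k) (hne : w' ≠ w) :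
    WindowInvariant k1 k2 k w (windowTable (T := T) (n := n) k1 k2 k w') := by
  intro ω i j hij
  have hb := le_and_le_of_mem_resWindows hw
  have hb' := le_and_le_of_mem_resWindows hw'
  funext u v t
  simp only [windowTable]
  rcases lt_trichotomy w'.1 w.1 with h | h | h
  · exact windowInvariant_tblCount (.inl (by omega)) _ _ _ ω i j hij
  · have hchild : ∀ {κ l c d x : ℕ} {u : Fin 2}, l + 1 ≤ κ → c ≠ d → x ∈ dblock κ l d →
        x ∉ dblock κ (l + 1) (2 * c + (u : ℕ)) := fun hl hcd hx hx' =>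
      hcd (eq_of_mem_dblock (mem_dblock_of_mem_child hl hx') hx)
    by_cases h1 : w'.2.1 = w.2.1
    · have h2 : w'.2.2 ≠ w.2.2 := fun h2 => hne (Prod.ext h (Prod.ext h1 h2))
      rw [h]
      exact tblCount_swapY_of_iff_right (iff_of_false (hchild hb.2.2.1 h2 hij.1.2)
        (hchild hb.2.2.1 h2 hij.2.1.2)) _ _
    · rw [h]
      exact tblCount_swapY_of_iff_left hij.2.2 (iff_of_false (hchild hb.2.1 h1 hij.1.1)
        (hchild hb.2.1 h1 hij.2.1.1)) _ _
  · exact windowInvariant_tblCount (.inr (by omega)) _ _ _ ω i j hij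

/-- Stratum-wise margins (first row, first column, total) of a `2 × 2 × T` table. -/
def tableMargins (τ : Fin 2 → Fin 2 → Fin T → ℕ) : Fin T → ℕ × ℕ × ℕ :=
  fun t => (τ 0 0 t + τ 0 1 t, τ 0 0 t + τ 1 0 t, τ 0 0 t + τ 0 1 t + (τ 1 0 t + τ 1 1 t))

theorem windowMargins_eq_tableMargins (hw : w ∈ resWindows k1 k2 k)
    (ω : Fin n → Fin (2 ^ k1) × Fin (2 ^ k2) × Fin T) :
    windowMargins k1 k2 k w ω = tableMargins (windowTable k1 k2 k w ω) := by
  have hb := le_and_le_of_mem_resWindows hw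
  funext t
  have hl := fun J => tblCount_union_left ω (fun x => mem_dblock_iff_children (j := w.2.1)
    (x := x) hb.2.1) (fun x => not_mem_dblock_succ) J t
  have hr := fun I => tblCount_union_right ω (fun x => mem_dblock_iff_children (j := w.2.2)
    (x := x) hb.2.2.1) (fun x => not_mem_dblock_succ) I t
  simp [windowMargins, tableMargins, windowTable, hl, hr]

/-- `τ'` arises from `τ` by moving one unit in stratum `t` from the diagonal to the
antidiagonal. -/
structure UnitMove (t : Fin T) (τ τ' : Fin 2 → Fin 2 → Fin T → ℕ) : Prop where
  margins : tableMargins τ' = tableMargins τ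
  corner : τ' 0 0 t + 1 = τ 0 0 t
  corner_of_ne : ∀ r, r ≠ t → τ' 0 0 r = τ 0 0 r

theorem table_ext {τ τ' : Fin 2 → Fin 2 → Fin T → ℕ} (h : tableMargins τ = tableMargins τ')
    (h0 : ∀ t, τ 0 0 t = τ' 0 0 t) : τ = τ' := by
  funext u v t
  have ht := congrFun h t
  have h0 := h0 t
  simp only [tableMargins, Prod.mk.injEq] at ht
  fin_cases u <;> fin_cases v <;> simp <;> omega

theorem UnitMove.eq_iff_eq {t : Fin T} {τ τ' σ σ' : Fin 2 → Fin 2 → Fin T → ℕ}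
    (h : UnitMove t τ τ') (h' : UnitMove t σ σ') : τ = σ ↔ τ' = σ' := by
  constructor
  · rintro rfl
    refine table_ext (h.margins.trans h'.margins.symm) fun r => ?_
    by_cases hr : r = t
    · subst hr; have := h.corner; have := h'.corner; omega
    · rw [h.corner_of_ne r hr, h'.corner_of_ne r hr]
  · rintro rfl
    refine table_ext (h.margins.symm.trans h'.margins) fun r => ?_
    by_cases hr : r = t
    · subst hr; have := h.corner; have := h'.corner; omega
    · rw [← h.corner_of_ne r hr, ← h'.corner_of_ne r hr]

/-- The product of the factorials of the entries of a table. -/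
def tableFactorial (τ : Fin 2 → Fin 2 → Fin T → ℕ) : ℝ :=
  ∏ t, (((τ 0 0 t).factorial * (τ 1 1 t).factorial) *
    ((τ 0 1 t).factorial * (τ 1 0 t).factorial) : ℕ)

theorem tableFactorial_pos (τ : Fin 2 → Fin 2 → Fin T → ℕ) : 0 < tableFactorial τ :=
  Finset.prod_pos fun t _ => by
    have h := fun m : ℕ => m.factorial_pos
    exact_mod_cast Nat.mul_pos (Nat.mul_pos (h _) (h _)) (Nat.mul_pos (h _) (h _))

theorem UnitMove.entries {t : Fin T} {τ τ' : Fin 2 → Fin 2 → Fin T → ℕ} (h : UnitMove t τ τ') :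
    τ 0 0 t = τ' 0 0 t + 1 ∧ τ 1 1 t = τ' 1 1 t + 1 ∧
      τ' 0 1 t = τ 0 1 t + 1 ∧ τ' 1 0 t = τ 1 0 t + 1 := by
  have h1 := congrFun h.margins t
  have h2 := h.corner
  simp only [tableMargins, Prod.mk.injEq] at h1
  omega

theorem UnitMove.entries_of_ne {t : Fin T} {τ τ' : Fin 2 → Fin 2 → Fin T → ℕ}
    (h : UnitMove t τ τ') {r : Fin T} (hr : r ≠ t) :
    τ 0 0 r = τ' 0 0 r ∧ τ 1 1 r = τ' 1 1 r ∧ τ' 0 1 r = τ 0 1 r ∧ τ' 1 0 r = τ 1 0 r := by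
  have h1 := congrFun h.margins r
  have h2 := h.corner_of_ne r hr
  simp only [tableMargins, Prod.mk.injEq] at h1
  omega

theorem UnitMove.tableFactorial_mul {t : Fin T} {τ τ' : Fin 2 → Fin 2 → Fin T → ℕ}
    (h : UnitMove t τ τ') :
    tableFactorial τ * (τ' 0 1 t * τ' 1 0 t) = tableFactorial τ' * (τ 0 0 t * τ 1 1 t) := by
  rw [tableFactorial, tableFactorial, ← Finset.mul_prod_erase _ _ (Finset.mem_univ t),
    ← Finset.mul_prod_erase Finset.univ _ (Finset.mem_univ t)]
  have hrest : ∀ r ∈ Finset.univ.erase t,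
      ((((τ 0 0 r).factorial * (τ 1 1 r).factorial) *
        ((τ 0 1 r).factorial * (τ 1 0 r).factorial) : ℕ) : ℝ) =
      (((τ' 0 0 r).factorial * (τ' 1 1 r).factorial) *
        ((τ' 0 1 r).factorial * (τ' 1 0 r).factorial) : ℕ) := by
    intro r hr
    obtain ⟨h1, h2, h3, h4⟩ := h.entries_of_ne (Finset.ne_of_mem_erase hr)
    rw [h1, h2, h3, h4]
  rw [Finset.prod_congr rfl hrest]
  obtain ⟨h1, h2, h3, h4⟩ := h.entries
  rw [h1, h2, h3, h4]
  push_cast [Nat.factorial_succ]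
  ring

theorem tableFactorial_invariant_of_unitMove {R : (Fin 2 → Fin 2 → Fin T → ℕ) → ℝ}
    (hR : ∀ t τ τ', UnitMove t τ τ' →
      R τ * (τ 0 0 t * τ 1 1 t) = R τ' * (τ' 0 1 t * τ' 1 0 t))
    {τ τ' : Fin 2 → Fin 2 → Fin T → ℕ} (h : tableMargins τ = tableMargins τ') :
    R τ * tableFactorial τ = R τ' * tableFactorial τ' := by
  have hmove : ∀ t τ τ', UnitMove t τ τ' →
      R τ * tableFactorial τ = R τ' * tableFactorial τ' := by
    intro t τ τ' h
    have h1 := hR t τ τ' h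
    have h2 := h.tableFactorial_mul
    obtain ⟨e1, e2, e3, e4⟩ := h.entries
    have hpos : (0 : ℝ) < τ' 0 1 t * τ' 1 0 t := by
      rw [e3, e4]; positivity
    refine mul_right_cancel₀ hpos.ne' ?_
    linear_combination R τ * h2 + tableFactorial τ' * h1
  obtain ⟨d, hd⟩ : ∃ d, d = ∑ t, Nat.dist (τ 0 0 t) (τ' 0 0 t) := ⟨_, rfl⟩
  induction d using Nat.strong_induction_on generalizing τ τ' with
  | _ d ih =>
    have step : ∀ {τ τ' : Fin 2 → Fin 2 → Fin T → ℕ} (t : Fin T),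
        tableMargins τ = tableMargins τ' → τ' 0 0 t < τ 0 0 t →
        d = ∑ t, Nat.dist (τ 0 0 t) (τ' 0 0 t) →
        R τ * tableFactorial τ = R τ' * tableFactorial τ' := by
      intro τ τ' t h ht hd
      have hm := fun r => congrFun h r
      simp only [tableMargins, Prod.mk.injEq] at hm
      let σ : Fin 2 → Fin 2 → Fin T → ℕ := fun u v r =>
        if r = t then (if u = v then τ u v r - 1 else τ u v r + 1) else τ u v r
      have hσ : UnitMove t τ σ := by
        have := hm t
        refine ⟨?_, by simp [σ]; omega, fun r hr => by simp [σ, hr]⟩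
        funext r
        by_cases hr : r = t
        · subst hr
          simp [σ, tableMargins]
          omega
        · simp [σ, tableMargins, hr]
      rw [hmove t τ σ hσ]
      refine ih (∑ t, Nat.dist (σ 0 0 t) (τ' 0 0 t)) ?_ (hσ.margins.trans h) rfl
      rw [hd]
      refine Finset.sum_lt_sum (fun r _ => ?_) ⟨t, Finset.mem_univ t, ?_⟩
      · by_cases hr : r = t
        · subst hr
          have := hσ.corner
          simp only [Nat.dist]
          omega
        · rw [hσ.corner_of_ne r hr]
      · have := hσ.corner
        simp only [Nat.dist]
        omega
    by_cases heq : ∀ t, τ 0 0 t = τ' 0 0 t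
    · rw [table_ext h heq]
    · push Not at heq
      obtain ⟨t, ht⟩ := heq
      rcases lt_or_gt_of_ne ht with ht | ht
      · exact (step t h.symm ht (by simpa only [Nat.dist_comm] using hd)).symm
      · exact step t h ht hd

/-- The sample point `i` is counted in the entry `(u, v, t)` of the table of the window `w`. -/
def InCell (k1 k2 k : ℕ) (w : ℕ × ℕ × ℕ) (u v : Fin 2) (t : Fin T)
    (ω : Fin n → Fin (2 ^ k1) × Fin (2 ^ k2) × Fin T) (i : Fin n) : Prop :=
  ((ω i).1 : ℕ) ∈ dblock k1 (w.1 + 1) (2 * w.2.1 + (u : ℕ)) ∧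
    ((ω i).2.1 : ℕ) ∈ dblock k2 (k - w.1 + 1) (2 * w.2.2 + (v : ℕ)) ∧ (ω i).2.2 = t

theorem inCell_swapY {t : Fin T} {ω : Fin n → Fin (2 ^ k1) × Fin (2 ^ k2) × Fin T}
    {i j : Fin n} {u v u' v' : Fin 2} :
    InCell k1 k2 k w u v' t (swapY i j ω) i ∧ InCell k1 k2 k w u' v t (swapY i j ω) j ↔
      InCell k1 k2 k w u v t ω i ∧ InCell k1 k2 k w u' v' t ω j := by
  simp only [InCell, swapY, Equiv.swap_apply_left, Equiv.swap_apply_right]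
  tauto

theorem InCell.sameWindow (hw : w ∈ resWindows k1 k2 k) {t : Fin T}
    {ω : Fin n → Fin (2 ^ k1) × Fin (2 ^ k2) × Fin T} {i j : Fin n} {u v u' v' : Fin 2}
    (hi : InCell k1 k2 k w u v t ω i) (hj : InCell k1 k2 k w u' v' t ω j) :
    SameWindow k1 k2 k w ω i j := by
  have hb := le_and_le_of_mem_resWindows hw
  exact ⟨⟨mem_dblock_of_mem_child hb.2.1 hi.1, mem_dblock_of_mem_child hb.2.2.1 hi.2.1⟩,
    ⟨mem_dblock_of_mem_child hb.2.1 hj.1, mem_dblock_of_mem_child hb.2.2.1 hj.2.1⟩,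
    hi.2.2.trans hj.2.2.symm⟩

theorem unitMove_swapY (hw : w ∈ resWindows k1 k2 k) {t : Fin T}
    {ω : Fin n → Fin (2 ^ k1) × Fin (2 ^ k2) × Fin T} {i j : Fin n}
    (hi : InCell k1 k2 k w 0 0 t ω i) (hj : InCell k1 k2 k w 1 1 t ω j) :
    UnitMove t (windowTable k1 k2 k w ω) (windowTable k1 k2 k w (swapY i j ω)) where
  margins := by
    rw [← windowMargins_eq_tableMargins hw, ← windowMargins_eq_tableMargins hw]
    exact windowInvariant_windowMargins ω i j (hi.sameWindow hw hj)
  corner := by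
    obtain ⟨h1, h2, rfl⟩ := hi
    exact tblCount_swapY_add_one ⟨h1, h2⟩
      ⟨fun h => not_mem_dblock_succ h hj.1, fun h => not_mem_dblock_succ h hj.2.1⟩
  corner_of_ne r hr := by
    obtain ⟨-, -, rfl⟩ := hi
    exact tblCount_swapY_of_ne hj.2.2.symm hr _ _

open Classical in
theorem windowTable_eq_sum (u v : Fin 2) (t : Fin T)
    (ω : Fin n → Fin (2 ^ k1) × Fin (2 ^ k2) × Fin T) :
    (windowTable k1 k2 k w ω u v t : ℝ) = ∑ i, if InCell k1 k2 k w u v t ω i then 1 else 0 := by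
  rw [Finset.sum_boole, windowTable, tblCount, Set.ncard_eq_toFinset_card',
    Set.toFinset_ofPred]
  simp only [InCell]
  congr

open Classical in
theorem sum_windowTable_eq_mul (ψ : (Fin n → Fin (2 ^ k1) × Fin (2 ^ k2) × Fin T) → ℝ)
    (τ : Fin 2 → Fin 2 → Fin T → ℕ) (t : Fin T) (u v u' v' : Fin 2) :
    (∑ ω, if windowTable k1 k2 k w ω = τ then ψ ω else 0) * (τ u v t * τ u' v' t) =
      ∑ i, ∑ j, ∑ ω, if windowTable k1 k2 k w ω = τ ∧ InCell k1 k2 k w u v t ω i ∧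
        InCell k1 k2 k w u' v' t ω j then ψ ω else 0 := by
  rw [Finset.sum_congr rfl fun i _ => Finset.sum_comm, Finset.sum_comm, Finset.sum_mul]
  refine Finset.sum_congr rfl fun ω _ => ?_
  by_cases h : windowTable k1 k2 k w ω = τ
  · simp only [← h, if_true, true_and]
    rw [windowTable_eq_sum, windowTable_eq_sum, Finset.sum_mul_sum, Finset.mul_sum]
    refine Finset.sum_congr rfl fun i _ => ?_
    rw [Finset.mul_sum]
    refine Finset.sum_congr rfl fun j _ => ?_
    by_cases hi : InCell k1 k2 k w u v t ω i <;> by_cases hj : InCell k1 k2 k w u' v' t ω j <;>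
      simp [hi, hj]
  · simp [h]

open Classical in
/-- For a swap-invariant weight, the total weight of `{windowTable = τ}` is, for fixed margins,
inversely proportional to `tableFactorial τ`. -/
theorem sum_windowTable_eq_mul_tableFactorial (hw : w ∈ resWindows k1 k2 k)
    {ψ : (Fin n → Fin (2 ^ k1) × Fin (2 ^ k2) × Fin T) → ℝ}
    (hψ : WindowInvariant k1 k2 k w ψ) {τ τ' : Fin 2 → Fin 2 → Fin T → ℕ}
    (h : tableMargins τ = tableMargins τ') :
    (∑ ω, if windowTable k1 k2 k w ω = τ then ψ ω else 0) * tableFactorial τ =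
      (∑ ω, if windowTable k1 k2 k w ω = τ' then ψ ω else 0) * tableFactorial τ' := by
  refine tableFactorial_invariant_of_unitMove
    (R := fun τ => ∑ ω, if windowTable k1 k2 k w ω = τ then ψ ω else 0)
    (fun t σ σ' hσ => ?_) h
  simp only [sum_windowTable_eq_mul]
  refine Finset.sum_congr rfl fun i _ => Finset.sum_congr rfl fun j _ => ?_
  refine Fintype.sum_equiv (swapY_involutive i j).toPerm _ _ fun ω => ?_
  simp only [Function.Involutive.coe_toPerm, inCell_swapY]
  by_cases hij : InCell k1 k2 k w 0 0 t ω i ∧ InCell k1 k2 k w 1 1 t ω j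
  · simp only [hψ ω i j (hij.1.sameWindow hw hij.2),
      (unitMove_swapY hw hij.1 hij.2).eq_iff_eq hσ]
  · simp [hij]

/-- The tables with entries at most `n`. -/
def tablesUpTo (T n : ℕ) : Finset (Fin 2 → Fin 2 → Fin T → ℕ) :=
  Fintype.piFinset fun _ => Fintype.piFinset fun _ => Fintype.piFinset fun _ =>
    Finset.range (n + 1)

theorem windowTable_mem_tablesUpTo (ω : Fin n → Fin (2 ^ k1) × Fin (2 ^ k2) × Fin T) :
    windowTable k1 k2 k w ω ∈ tablesUpTo T n := by
  simp only [tablesUpTo, Fintype.mem_piFinset, Finset.mem_range, Nat.lt_succ_iff]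
  intro u v t
  exact (Set.ncard_le_card _).trans_eq (Nat.card_fin n)

open Classical in
/-- The (multi-stratum) hypergeometric probability of `A` given the margins `m`. -/
noncomputable def hypergeometricProb (n : ℕ) (A : Set (Fin 2 → Fin 2 → Fin T → ℕ))
    (m : Fin T → ℕ × ℕ × ℕ) : ℝ :=
  (∑ τ ∈ tablesUpTo T n, if tableMargins τ = m ∧ τ ∈ A then (tableFactorial τ)⁻¹ else 0) /
    ∑ τ ∈ tablesUpTo T n, if tableMargins τ = m then (tableFactorial τ)⁻¹ else 0

open Classical in
theorem sum_eq_sum_tables (ψ : (Fin n → Fin (2 ^ k1) × Fin (2 ^ k2) × Fin T) → ℝ)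
    (g : (Fin 2 → Fin 2 → Fin T → ℕ) → ℝ) :
    ∑ ω, ψ ω * g (windowTable k1 k2 k w ω) =
      ∑ τ ∈ tablesUpTo T n, (∑ ω, if windowTable k1 k2 k w ω = τ then ψ ω else 0) * g τ := by
  simp only [Finset.sum_mul]
  rw [Finset.sum_comm]
  refine Finset.sum_congr rfl fun ω _ => ?_
  simp [ite_mul, windowTable_mem_tablesUpTo]

open Classical in
theorem sum_mul_hypergeometricProb (hw : w ∈ resWindows k1 k2 k)
    {ψ : (Fin n → Fin (2 ^ k1) × Fin (2 ^ k2) × Fin T) → ℝ}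
    (hψ : WindowInvariant k1 k2 k w ψ) (A : Set (Fin 2 → Fin 2 → Fin T → ℕ)) :
    ∑ ω, ψ ω * hypergeometricProb n A (windowMargins k1 k2 k w ω) =
      ∑ ω, ψ ω * A.indicator (fun _ => 1) (windowTable k1 k2 k w ω) := by
  simp only [windowMargins_eq_tableMargins hw]
  rw [sum_eq_sum_tables ψ fun τ => hypergeometricProb n A (tableMargins τ),
    sum_eq_sum_tables ψ (A.indicator fun _ => 1)]
  set R : (Fin 2 → Fin 2 → Fin T → ℕ) → ℝ :=
    fun τ => ∑ ω, if windowTable k1 k2 k w ω = τ then ψ ω else 0 with hR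
  set Z : (Fin T → ℕ × ℕ × ℕ) → ℝ := fun m =>
    ∑ τ ∈ tablesUpTo T n, if tableMargins τ = m then (tableFactorial τ)⁻¹ else 0 with hZ
  have hZpos : ∀ τ ∈ tablesUpTo T n, 0 < Z (tableMargins τ) := fun τ hτ =>
    Finset.sum_pos' (fun σ _ => by
      split_ifs
      · exact (inv_pos.2 (tableFactorial_pos σ)).le
      · exact le_rfl) ⟨τ, hτ, by simpa using tableFactorial_pos τ⟩
  have hRF : ∀ τ σ, tableMargins τ = tableMargins σ →
      R τ * (tableFactorial σ)⁻¹ = R σ * (tableFactorial τ)⁻¹ := by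
    intro τ σ h
    have := sum_windowTable_eq_mul_tableFactorial hw hψ h
    have h1 := (tableFactorial_pos τ).ne'
    have h2 := (tableFactorial_pos σ).ne'
    field_simp
    exact this.trans (mul_comm _ _)
  calc ∑ τ ∈ tablesUpTo T n, R τ * hypergeometricProb n A (tableMargins τ)
      = ∑ τ ∈ tablesUpTo T n, ∑ σ ∈ tablesUpTo T n,
          if tableMargins σ = tableMargins τ ∧ σ ∈ A then
            R σ * (tableFactorial τ)⁻¹ / Z (tableMargins σ) else 0 := by
        refine Finset.sum_congr rfl fun τ _ => ?_
        rw [hypergeometricProb, ← mul_div_assoc, Finset.mul_sum, Finset.sum_div]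
        refine Finset.sum_congr rfl fun σ _ => ?_
        split_ifs with h
        · rw [hRF τ σ h.1.symm, h.1]
        · simp
    _ = ∑ σ ∈ tablesUpTo T n, R σ * A.indicator (fun _ => 1) σ := by
        rw [Finset.sum_comm]
        refine Finset.sum_congr rfl fun σ hσ => ?_
        by_cases hA : σ ∈ A
        · have : ∀ τ, (if tableMargins σ = tableMargins τ ∧ σ ∈ A then
              R σ * (tableFactorial τ)⁻¹ / Z (tableMargins σ) else 0) =
              R σ / Z (tableMargins σ) *
                (if tableMargins τ = tableMargins σ then (tableFactorial τ)⁻¹ else 0) := by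
            intro τ
            by_cases h : tableMargins τ = tableMargins σ
            · simp [h, hA]; ring
            · simp [h, Ne.symm h]
          rw [Finset.sum_congr rfl fun τ _ => this τ, ← Finset.mul_sum]
          change R σ / Z (tableMargins σ) * Z (tableMargins σ) = _
          rw [div_mul_cancel₀ _ (hZpos σ hσ).ne']
          simp [hA]
        · simp [hA]

end Window

section CondExp

variable {k1 k2 T n k : ℕ} {w : ℕ × ℕ × ℕ}

theorem windowInvariant_pi_singleton {s : Fin T → ℝ} (hs0 : ∀ t, 0 ≤ s t)
    {a : Fin T → Fin (2 ^ k1) → ℝ} (ha0 : ∀ t x, 0 ≤ a t x)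
    {b : Fin T → Fin (2 ^ k2) → ℝ} (hb0 : ∀ t y, 0 ≤ b t y)
    (P : Measure (Fin (2 ^ k1) × Fin (2 ^ k2) × Fin T)) [IsProbabilityMeasure P]
    (hP : ∀ x y t, P {(x, y, t)} = ENNReal.ofReal (s t * a t x * b t y)) (w : ℕ × ℕ × ℕ) :
    WindowInvariant k1 k2 k w fun ω => (Measure.pi fun _ : Fin n => P).real {ω} := by
  have hreal : ∀ ω, (Measure.pi fun _ : Fin n => P).real {ω} =
      ∏ m, (s (ω m).2.2 * a (ω m).2.2 (ω m).1 * b (ω m).2.2 (ω m).2.1) := by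
    intro ω
    rw [measureReal_def, Measure.pi_singleton, ENNReal.toReal_prod]
    refine Finset.prod_congr rfl fun m _ => ?_
    rw [show ω m = ((ω m).1, (ω m).2.1, (ω m).2.2) from rfl, hP, ENNReal.toReal_ofReal]
    exact mul_nonneg (mul_nonneg (hs0 _) (ha0 _ _)) (hb0 _ _)
  intro ω i j hij
  simp only [hreal]
  exact prod_swapY hij.2.2 (fun t x => s t * a t x) b

variable (μ : Measure (Fin n → Fin (2 ^ k1) × Fin (2 ^ k2) × Fin T)) [IsFiniteMeasure μ]

theorem integral_mul_hypergeometricProb (hw : w ∈ resWindows k1 k2 k)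
    (hμ : WindowInvariant k1 k2 k w fun ω => μ.real {ω})
    {φ : (Fin n → Fin (2 ^ k1) × Fin (2 ^ k2) × Fin T) → ℝ}
    (hφ : WindowInvariant k1 k2 k w φ) (A : Set (Fin 2 → Fin 2 → Fin T → ℕ)) :
    ∫ ω, φ ω * hypergeometricProb n A (windowMargins k1 k2 k w ω) ∂μ =
      ∫ ω, φ ω * A.indicator (fun _ => 1) (windowTable k1 k2 k w ω) ∂μ := by
  rw [integral_fintype .of_finite, integral_fintype .of_finite]
  simp only [smul_eq_mul, ← mul_assoc]
  refine sum_mul_hypergeometricProb hw (fun ω i j hij => ?_) A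
  exact congrArg₂ (· * ·) (hμ ω i j hij) (hφ ω i j hij)

theorem ae_eq_condExp_comap_of_integral_eq {Ω γ : Type*} [MeasurableSpace Ω] [Finite Ω]
    [DiscreteMeasurableSpace Ω] [MeasurableSpace γ] (μ : Measure Ω) [IsFiniteMeasure μ]
    {G : Ω → γ} {F f : Ω → ℝ} (hF : Measurable[MeasurableSpace.comap G inferInstance] F)
    (h : ∀ B : Set γ, ∫ ω, B.indicator (fun _ => 1) (G ω) * F ω ∂μ =
      ∫ ω, B.indicator (fun _ => 1) (G ω) * f ω ∂μ) :
    F =ᵐ[μ] μ[f | MeasurableSpace.comap G inferInstance] := by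
  have hm : MeasurableSpace.comap G inferInstance ≤ (inferInstance : MeasurableSpace Ω) :=
    Measurable.of_discrete.comap_le
  refine ae_eq_condExp_of_forall_setIntegral_eq hm .of_finite (fun _ _ _ => Integrable.of_finite) ?_
    hF.stronglyMeasurable.aestronglyMeasurable
  rintro _ ⟨B, hB, rfl⟩ -
  have e : ∀ f : Ω → ℝ, ∫ ω in G ⁻¹' B, f ω ∂μ =
      ∫ ω, B.indicator (fun _ => 1) (G ω) * f ω ∂μ := by
    intro f
    rw [← integral_indicator (.of_discrete)]
    congr 1
    funext ω
    by_cases hω : G ω ∈ B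
    · simp [hω]
    · simp [hω]
  rw [e, e, h]

theorem condExp_windowTable_windowMargins (hw : w ∈ resWindows k1 k2 k)
    (hμ : WindowInvariant k1 k2 k w fun ω => μ.real {ω})
    (A : Set (Fin 2 → Fin 2 → Fin T → ℕ)) :
    (fun ω => hypergeometricProb n A (windowMargins k1 k2 k w ω)) =ᵐ[μ]
      μ[Set.indicator {ω | windowTable k1 k2 k w ω ∈ A} (fun _ => (1 : ℝ)) |
        MeasurableSpace.comap (windowMargins k1 k2 k w) MeasurableSpace.pi] :=
  ae_eq_condExp_comap_of_integral_eq μ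
    ((Measurable.of_discrete (f := hypergeometricProb n A)).comp (comap_measurable _))
    fun B => integral_mul_hypergeometricProb μ hw hμ
      (windowInvariant_windowMargins.comp (B.indicator fun _ => 1)) A

theorem measurable_tblCount_comap_resCounts {l₁ l₂ j₁ j₂ : ℕ} (h : l₁ + l₂ = k + 1)
    (h₁ : l₁ ≤ k1) (h₂ : l₂ ≤ k2) (hj₁ : j₁ < 2 ^ l₁) (hj₂ : j₂ < 2 ^ l₂) (t : Fin T) :
    Measurable[MeasurableSpace.comap (resCounts (n := n) k1 k2 k) MeasurableSpace.pi]
      fun ω => tblCount ω (dblock k1 l₁ j₁) (dblock k2 l₂ j₂) t := by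
  have := (measurable_pi_apply (X := fun _ : ℕ × ℕ × ℕ × ℕ × Fin T => ℕ)
    (l₁, l₂, j₁, j₂, t)).comp (comap_measurable (resCounts (T := T) (n := n) k1 k2 k))
  convert this using 1
  funext ω
  simp [resCounts, h, h₁, h₂, hj₁, hj₂]

theorem measurable_windowMargins_comap_resCounts (hw : w ∈ resWindows k1 k2 k) :
    Measurable[MeasurableSpace.comap (resCounts (T := T) (n := n) k1 k2 k) MeasurableSpace.pi]
      (windowMargins (T := T) (n := n) k1 k2 k w) := by
  obtain ⟨h0, h1, h2, h3, h4⟩ := le_and_le_of_mem_resWindows hw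
  have hp := pow_succ 2 w.1
  have hq := pow_succ 2 (k - w.1)
  refine @measurable_pi_lambda _ _ _ (_) _ _ fun t => ?_
  refine Measurable.prodMk ?_ (Measurable.prodMk ?_ ?_)
  · exact measurable_tblCount_comap_resCounts (by omega) h1 (by omega) (by omega) h4 t
  · exact measurable_tblCount_comap_resCounts (by omega) (by omega) h2 h3 (by omega) t
  · simp only [tblCount_union_left _ (fun x => mem_dblock_iff_children (j := w.2.1) (x := x) h1)
      (fun x => not_mem_dblock_succ)]
    exact (measurable_tblCount_comap_resCounts (by omega) h1 (by omega) (by omega) h4 t).add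
      (measurable_tblCount_comap_resCounts (by omega) h1 (by omega) (by omega) h4 t)

theorem condExp_windowTable_resCounts (hw : w ∈ resWindows k1 k2 k)
    (hμ : WindowInvariant k1 k2 k w fun ω => μ.real {ω})
    (A : Set (Fin 2 → Fin 2 → Fin T → ℕ)) :
    (fun ω => hypergeometricProb n A (windowMargins k1 k2 k w ω)) =ᵐ[μ]
      μ[Set.indicator {ω | windowTable k1 k2 k w ω ∈ A} (fun _ => (1 : ℝ)) |
        MeasurableSpace.comap (resCounts k1 k2 k) MeasurableSpace.pi] :=
  ae_eq_condExp_comap_of_integral_eq μ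
    ((Measurable.of_discrete (f := hypergeometricProb n A)).comp
      (measurable_windowMargins_comap_resCounts hw))
    fun B => integral_mul_hypergeometricProb μ hw hμ
      (windowInvariant_resCounts.comp (B.indicator fun _ => 1)) A

theorem windowMargins_eq_of_resCounts_eq (hw : w ∈ resWindows k1 k2 k)
    {ω ω' : Fin n → Fin (2 ^ k1) × Fin (2 ^ k2) × Fin T}
    (h : resCounts k1 k2 k ω = resCounts k1 k2 k ω') :
    windowMargins k1 k2 k w ω = windowMargins k1 k2 k w ω' := by
  obtain ⟨B, -, hB⟩ := measurable_windowMargins_comap_resCounts (T := T) (n := n) hw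
    (measurableSet_singleton (windowMargins k1 k2 k w ω'))
  have hmem : ω' ∈ resCounts k1 k2 k ⁻¹' B := by rw [hB]; rfl
  have : ω ∈ resCounts k1 k2 k ⁻¹' B := by rwa [Set.mem_preimage, h]
  rwa [hB] at this

theorem windowInvariant_windowMargins_of_mem {w' : ℕ × ℕ × ℕ} (hw' : w' ∈ resWindows k1 k2 k) :
    WindowInvariant k1 k2 k w (windowMargins (T := T) (n := n) k1 k2 k w') :=
  fun ω i j hij => windowMargins_eq_of_resCounts_eq hw' (windowInvariant_resCounts ω i j hij)

theorem integral_mul_prod_hypergeometricProb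
    (hμ : ∀ w, WindowInvariant k1 k2 k w fun ω => μ.real {ω})
    (A : ℕ × ℕ × ℕ → Set (Fin 2 → Fin 2 → Fin T → ℕ)) (g : (ℕ × ℕ × ℕ × ℕ × Fin T → ℕ) → ℝ)
    {S : Finset (ℕ × ℕ × ℕ)} (hS : S ⊆ resWindows k1 k2 k) :
    ∫ ω, g (resCounts k1 k2 k ω) *
        ∏ w ∈ S, hypergeometricProb n (A w) (windowMargins k1 k2 k w ω) ∂μ =
      ∫ ω, g (resCounts k1 k2 k ω) *
        ∏ w ∈ S, (A w).indicator (fun _ => 1) (windowTable k1 k2 k w ω) ∂μ := by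
  suffices h : ∀ U ⊆ resWindows k1 k2 k, Disjoint S U →
      ∫ ω, (g (resCounts k1 k2 k ω) *
        ∏ w ∈ U, hypergeometricProb n (A w) (windowMargins k1 k2 k w ω)) *
        ∏ w ∈ S, hypergeometricProb n (A w) (windowMargins k1 k2 k w ω) ∂μ =
      ∫ ω, (g (resCounts k1 k2 k ω) *
        ∏ w ∈ U, hypergeometricProb n (A w) (windowMargins k1 k2 k w ω)) *
        ∏ w ∈ S, (A w).indicator (fun _ => 1) (windowTable k1 k2 k w ω) ∂μ by
    simpa using h ∅ (Finset.empty_subset _) (Finset.disjoint_empty_right _)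
  induction S using Finset.induction_on with
  | empty => simp
  | insert v S hv ih =>
    intro U hU hd
    rw [Finset.insert_subset_iff] at hS
    rw [Finset.disjoint_insert_left] at hd
    have h1 := ih hS.2 (insert v U) (Finset.insert_subset hS.1 hU)
      (Finset.disjoint_insert_right.2 ⟨hv, hd.2⟩)
    have hinv : WindowInvariant (n := n) k1 k2 k v fun ω => (g (resCounts k1 k2 k ω) *
        ∏ w ∈ U, hypergeometricProb n (A w) (windowMargins k1 k2 k w ω)) *
        ∏ w ∈ S, (A w).indicator (fun _ => (1 : ℝ)) (windowTable k1 k2 k w ω) := by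
      intro ω i j hij
      simp only
      rw [windowInvariant_resCounts ω i j hij]
      congr 1
      · congr 1
        refine Finset.prod_congr rfl fun u hu => ?_
        rw [windowInvariant_windowMargins_of_mem (hU hu) ω i j hij]
      · refine Finset.prod_congr rfl fun u hu => ?_
        rw [windowInvariant_windowTable hS.1 (hS.2 hu) (ne_of_mem_of_not_mem hu hv) ω i j hij]
    have h2 := integral_mul_hypergeometricProb μ hS.1 (hμ v) hinv (A v)
    simp only [Finset.prod_insert hv, Finset.prod_insert hd.1] at h1 ⊢
    calc _ = _ := integral_congr_ae (.of_forall fun ω => by ring)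
      _ = _ := h1
      _ = _ := integral_congr_ae (.of_forall fun ω => by ring)
      _ = _ := h2
      _ = _ := integral_congr_ae (.of_forall fun ω => by ring)

theorem condExp_windowTables_resCounts
    (hμ : ∀ w, WindowInvariant k1 k2 k w fun ω => μ.real {ω})
    (A : ℕ × ℕ × ℕ → Set (Fin 2 → Fin 2 → Fin T → ℕ)) :
    (fun ω => ∏ w ∈ resWindows k1 k2 k,
        hypergeometricProb n (A w) (windowMargins k1 k2 k w ω)) =ᵐ[μ]
      μ[Set.indicator {ω | ∀ w ∈ resWindows k1 k2 k, windowTable k1 k2 k w ω ∈ A w}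
          (fun _ => (1 : ℝ)) |
        MeasurableSpace.comap (resCounts k1 k2 k) MeasurableSpace.pi] := by
  refine ae_eq_condExp_comap_of_integral_eq μ
    (Finset.measurable_prod _ fun w hw =>
      (Measurable.of_discrete (f := hypergeometricProb n (A w))).comp
        (measurable_windowMargins_comap_resCounts hw)) fun B => ?_
  rw [integral_mul_prod_hypergeometricProb μ hμ A (B.indicator fun _ => 1) subset_rfl]
  congr 1
  funext ω
  congr 1
  by_cases h : ∀ w ∈ resWindows k1 k2 k, windowTable k1 k2 k w ω ∈ A w
  · rw [Set.indicator_of_mem (by exact h)]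
    exact Finset.prod_eq_one fun w hw => Set.indicator_of_mem (h w hw) _
  · rw [Set.indicator_of_notMem (by exact h)]
    push Not at h
    obtain ⟨w, hw, hA⟩ := h
    exact Finset.prod_eq_zero hw (Set.indicator_of_notMem hA _)

end CondExp

/-- exact conditional independence of same-resolution windows: for i.i.d.
samples from a conditionally independent law `q(x,y,t) = s(t)·a_t(x)·b_t(y)`, given the
σ-algebra `𝔊_k` generated by all counts of resolution `k + 1`, events determined by the
window tables of distinct resolution-`k` windows are conditionally independent; moreover,
the conditional probability of each such event given `𝔊_k` coincides a.s. with its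
conditional probability given only the window's own stratum-specific margin counts. -/
theorem same_resolution_windows_conditionally_independent
    (k1 k2 T n : ℕ) (hk1 : 1 ≤ k1) (hk2 : 1 ≤ k2) (hT : 1 ≤ T)
    (s : Fin T → ℝ) (hs0 : ∀ t, 0 ≤ s t) (hs1 : ∑ t, s t = 1)
    (a : Fin T → Fin (2 ^ k1) → ℝ) (ha0 : ∀ t x, 0 ≤ a t x) (ha1 : ∀ t, ∑ x, a t x = 1)
    (b : Fin T → Fin (2 ^ k2) → ℝ) (hb0 : ∀ t y, 0 ≤ b t y) (hb1 : ∀ t, ∑ y, b t y = 1)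
    (P : Measure (Fin (2 ^ k1) × Fin (2 ^ k2) × Fin T)) [IsProbabilityMeasure P]
    (hP : ∀ x y t, P {(x, y, t)} = ENNReal.ofReal (s t * a t x * b t y))
    (k : ℕ) (hk : k ≤ k1 + k2 - 2)
    (A : ℕ × ℕ × ℕ → Set (Fin 2 → Fin 2 → Fin T → ℕ)) :
    ((Measure.pi fun _ : Fin n => P)[Set.indicator
          {ω | ∀ w ∈ resWindows k1 k2 k, windowTable k1 k2 k w ω ∈ A w} (fun _ => (1 : ℝ)) |
        MeasurableSpace.comap (resCounts k1 k2 k) MeasurableSpace.pi]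
      =ᵐ[Measure.pi fun _ : Fin n => P]
      fun ω => ∏ w ∈ resWindows k1 k2 k,
        ((Measure.pi fun _ : Fin n => P)[Set.indicator
            {ω' | windowTable k1 k2 k w ω' ∈ A w} (fun _ => (1 : ℝ)) |
          MeasurableSpace.comap (resCounts k1 k2 k) MeasurableSpace.pi]) ω) ∧
    ∀ w ∈ resWindows k1 k2 k,
      ((Measure.pi fun _ : Fin n => P)[Set.indicator
            {ω' | windowTable k1 k2 k w ω' ∈ A w} (fun _ => (1 : ℝ)) |
          MeasurableSpace.comap (resCounts k1 k2 k) MeasurableSpace.pi]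
        =ᵐ[Measure.pi fun _ : Fin n => P]
        (Measure.pi fun _ : Fin n => P)[Set.indicator
            {ω' | windowTable k1 k2 k w ω' ∈ A w} (fun _ => (1 : ℝ)) |
          MeasurableSpace.comap (windowMargins k1 k2 k w) MeasurableSpace.pi]) := by
  have hψ := windowInvariant_pi_singleton (n := n) (k := k) hs0 ha0 hb0 P hP
  have hG := fun w (hw : w ∈ resWindows k1 k2 k) =>
    condExp_windowTable_resCounts (Measure.pi fun _ : Fin n => P) hw (hψ w) (A w)
  refine ⟨?_, fun w hw => (hG w hw).symm.trans
    (condExp_windowTable_windowMargins (Measure.pi fun _ : Fin n => P) hw (hψ w) (A w))⟩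
  have hall := (Filter.eventually_all_finset (resWindows k1 k2 k)).2 hG
  refine (condExp_windowTables_resCounts (Measure.pi fun _ : Fin n => P) hψ A).symm.trans ?_
  filter_upwards [hall] with ω hω
  exact Finset.prod_congr rfl hω
end

section
/- Let (𝒵, 𝒜, ν) be a probability space and a, b : 𝒵 → [0,1] measurable. For x, y ∈ {0,1} set f_0 = a, f_1 = 1−a, g_0 = b, g_1 = 1−b, and define two pmfs on {0,1}×{0,1}: the mixture of products P(x,y) = ∫ f_x(z)·g_y(z) dν(z), and the product of mixtures Q(x,y) = (∫ f_x dν)·(∫ g_y dν). Then D_H²(P, Q) ≤ 6·∫∫∫ D_H²(Ber(a(z)), Ber(a(z')))·D_H²(Ber(b(z)), Ber(b(z''))) dν(z) dν(z') dν(z''), where the triple integral is over independent z, z', z'' each distributed according to ν. -/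
open MeasureTheory

/-- Squared Hellinger distance between two pmfs on a finite set. -/
noncomputable def hellSq {S : Type*} [Fintype S] (p q : S → ℝ) : ℝ :=
  (1 / 2) * ∑ s, (Real.sqrt (p s) - Real.sqrt (q s)) ^ 2

/-- The Bernoulli pmf `(u, 1-u)` on `{0,1}` (encoded as `Fin 2`). -/
def ber (u : ℝ) : Fin 2 → ℝ := ![u, 1 - u]

theorem abs_sqrt_sub_sqrt_mul_le {s t v w c : ℝ} (hs : 0 ≤ s) (ht : 0 ≤ t) (hv : 0 ≤ v)
    (hw : 0 ≤ w) (hc : c ^ 2 ≤ v * w) :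
    |√(s ^ 2 * t ^ 2 + s ^ 2 * w + t ^ 2 * v + 2 * s * t * c) - √((s ^ 2 + v) * (t ^ 2 + w))|
      ≤ √(v * w) := by
  have hst : 0 ≤ s * t := mul_nonneg hs ht
  have hvw : 0 ≤ v * w := mul_nonneg hv hw
  have he := Real.sq_sqrt hvw
  have he0 := Real.sqrt_nonneg (v * w)
  obtain ⟨hc₁, hc₂⟩ := abs_le.mp (Real.abs_le_sqrt hc)
  have hAG : 2 * (s * t) * √(v * w) ≤ s ^ 2 * w + t ^ 2 * v := by
    rw [Real.sqrt_mul hv]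
    nlinarith [sq_nonneg (s * √w - t * √v), Real.sq_sqrt hv, Real.sq_sqrt hw]
  set e := √(v * w)
  have hc₁' : 0 ≤ s * t * (c + e) := mul_nonneg hst (by linarith)
  have hc₂' : 0 ≤ s * t * (e - c) := mul_nonneg hst (by linarith)
  have hl : (s * t) ^ 2 ≤ s ^ 2 * t ^ 2 + s ^ 2 * w + t ^ 2 * v + 2 * s * t * c := by
    linarith
  have hq : (s * t) ^ 2 ≤ (s ^ 2 + v) * (t ^ 2 + w) := by
    linarith [mul_nonneg (sq_nonneg s) hw, mul_nonneg (sq_nonneg t) hv]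
  have hll := Real.sq_sqrt ((sq_nonneg _).trans hl)
  have hqq := Real.sq_sqrt ((sq_nonneg _).trans hq)
  have hl' := mul_le_mul_of_nonneg_right (Real.le_sqrt_of_sq_le hl) he0
  have hq' := mul_le_mul_of_nonneg_right (Real.le_sqrt_of_sq_le hq) he0
  have hl0 := Real.sqrt_nonneg (s ^ 2 * t ^ 2 + s ^ 2 * w + t ^ 2 * v + 2 * s * t * c)
  have hq0 := Real.sqrt_nonneg ((s ^ 2 + v) * (t ^ 2 + w))
  set l := √(s ^ 2 * t ^ 2 + s ^ 2 * w + t ^ 2 * v + 2 * s * t * c)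
  set q := √((s ^ 2 + v) * (t ^ 2 + w))
  rw [abs_le]
  constructor
  · suffices q ≤ l + e by linarith
    refine (sq_le_sq₀ hq0 (by linarith)).mp ?_
    linarith
  · suffices l ≤ q + e by linarith
    refine (sq_le_sq₀ hl0 (by linarith)).mp ?_
    linarith

section BoundedFunctions

variable {Z : Type*} [MeasurableSpace Z] {ν : Measure Z}

theorem MeasureTheory.MemLp.top_mul {f g : Z → ℝ} (hf : MemLp f ⊤ ν) (hg : MemLp g ⊤ ν) :
    MemLp (fun z => f z * g z) ⊤ ν :=
  hg.mul (r := ⊤) hf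

theorem MeasureTheory.MemLp.top_sq {f : Z → ℝ} (hf : MemLp f ⊤ ν) :
    MemLp (fun z => f z ^ 2) ⊤ ν := by
  simpa only [sq] using hf.top_mul hf

variable [IsProbabilityMeasure ν]

theorem sq_integral_mul_le {f g : Z → ℝ} (hf : MemLp f ⊤ ν) (hg : MemLp g ⊤ ν) :
    (∫ z, f z * g z ∂ν) ^ 2 ≤ (∫ z, f z ^ 2 ∂ν) * ∫ z, g z ^ 2 ∂ν := by
  have h : ∀ t : ℝ, 0 ≤ (∫ z, f z ^ 2 ∂ν) * (t * t) + (2 * ∫ z, f z * g z ∂ν) * t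
      + ∫ z, g z ^ 2 ∂ν := fun t => by
    have i₁ := (hf.top_sq.integrable le_top).mul_const (t * t)
    have i₂ := ((hf.top_mul hg).integrable le_top).const_mul 2 |>.mul_const t
    have i₃ := hg.top_sq.integrable le_top
    rw [← integral_const_mul, ← integral_mul_const, ← integral_mul_const,
      ← integral_add i₁ i₂, ← integral_add (i₁.fun_add i₂) i₃]
    refine integral_nonneg fun z => ?_
    change 0 ≤ f z ^ 2 * (t * t) + 2 * (f z * g z) * t + g z ^ 2
    nlinarith [sq_nonneg (f z * t + g z)]
  have := discrim_le_zero h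
  rw [discrim] at this
  linarith

theorem sqrt_integral_add_sq_le {f g : Z → ℝ} (hf : MemLp f ⊤ ν) (hg : MemLp g ⊤ ν) :
    √(∫ z, (f z + g z) ^ 2 ∂ν) ≤ √(∫ z, f z ^ 2 ∂ν) + √(∫ z, g z ^ 2 ∂ν) := by
  have hf0 : 0 ≤ ∫ z, f z ^ 2 ∂ν := integral_nonneg fun z => sq_nonneg _
  have hg0 : 0 ≤ ∫ z, g z ^ 2 ∂ν := integral_nonneg fun z => sq_nonneg _
  have i₁ := hf.top_sq.integrable le_top
  have i₂ := ((hf.top_mul hg).integrable le_top).const_mul 2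
  have i₃ := hg.top_sq.integrable le_top
  have key : ∫ z, (f z + g z) ^ 2 ∂ν
      = (∫ z, f z ^ 2 ∂ν) + 2 * (∫ z, f z * g z ∂ν) + ∫ z, g z ^ 2 ∂ν := by
    rw [← integral_const_mul, ← integral_add i₁ i₂, ← integral_add (i₁.fun_add i₂) i₃]
    refine integral_congr_ae (.of_forall fun z => ?_)
    change (f z + g z) ^ 2 = f z ^ 2 + 2 * (f z * g z) + g z ^ 2
    ring
  have hcs : ∫ z, f z * g z ∂ν ≤ √(∫ z, f z ^ 2 ∂ν) * √(∫ z, g z ^ 2 ∂ν) := by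
    rw [← Real.sqrt_mul hf0]
    exact Real.le_sqrt_of_sq_le (sq_integral_mul_le hf hg)
  refine Real.sqrt_le_iff.mpr ⟨by positivity, ?_⟩
  rw [key, add_sq, Real.sq_sqrt hf0, Real.sq_sqrt hg0]
  linarith

theorem integral_sub_sq_eq {f : Z → ℝ} (hf : MemLp f ⊤ ν) (c : ℝ) :
    ∫ z, (c - f z) ^ 2 ∂ν
      = (c - ∫ z, f z ∂ν) ^ 2 + ∫ z, (f z - ∫ w, f w ∂ν) ^ 2 ∂ν := by
  set s := ∫ z, f z ∂ν
  have i := hf.integrable le_top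
  have i₁ : Integrable (fun z => (f z - s) ^ 2) ν :=
    (hf.sub (memLp_const s)).top_sq.integrable le_top
  have i₂ : Integrable (fun z => 2 * (s - c) * (f z - s)) ν :=
    (i.sub (integrable_const s)).const_mul _
  have h0 : ∫ z, (f z - s) ∂ν = 0 := by
    rw [integral_sub i (integrable_const s)]
    simp [s]
  calc ∫ z, (c - f z) ^ 2 ∂ν
      = ∫ z, ((f z - s) ^ 2 + 2 * (s - c) * (f z - s) + (c - s) ^ 2) ∂ν := by
        congr 1; ext z; ring
    _ = _ := by
        rw [integral_add (i₁.fun_add i₂) (integrable_const _), integral_add i₁ i₂,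
          integral_const_mul, h0]
        simp
        ring

/-- Compares the `L²` norms of `f * g` under `ν` and of the tensor product `f ⊗ g`
under `ν.prod ν`. -/
theorem sq_sqrt_integral_sub_sqrt_le {f g : Z → ℝ} (hf : MemLp f ⊤ ν) (hg : MemLp g ⊤ ν)
    (hf0 : ∀ z, 0 ≤ f z) (hg0 : ∀ z, 0 ≤ g z) :
    (√(∫ z, f z ^ 2 * g z ^ 2 ∂ν) - √((∫ z, f z ^ 2 ∂ν) * ∫ z, g z ^ 2 ∂ν)) ^ 2
      ≤ 2 * ∫ z, (∫ z', (f z - f z') ^ 2 ∂ν) * (∫ z'', (g z - g z'') ^ 2 ∂ν) ∂ν := by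
  have ef := integral_sub_sq_eq hf
  have eg := integral_sub_sq_eq hg
  set s := ∫ z, f z ∂ν with hs
  set t := ∫ z, g z ∂ν with ht
  have hs0 : 0 ≤ s := integral_nonneg hf0
  have ht0 : 0 ≤ t := integral_nonneg hg0
  obtain ⟨x, hx⟩ : ∃ x : Z → ℝ, x = fun z => f z - s := ⟨_, rfl⟩
  obtain ⟨y, hy⟩ : ∃ y : Z → ℝ, y = fun z => g z - t := ⟨_, rfl⟩
  have fx : ∀ z, f z = x z + s := fun z => by simp [hx]
  have gy : ∀ z, g z = y z + t := fun z => by simp [hy]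
  have hxm : MemLp x ⊤ ν := hx ▸ hf.sub (memLp_const s)
  have hym : MemLp y ⊤ ν := hy ▸ hg.sub (memLp_const t)
  have ex : ∫ z, x z ∂ν = 0 := by
    rw [hx, integral_sub (hf.integrable le_top) (integrable_const s)]; simp [hs]
  have ey : ∫ z, y z ∂ν = 0 := by
    rw [hy, integral_sub (hg.integrable le_top) (integrable_const t)]; simp [ht]
  clear hx hy hs ht
  clear_value s t
  simp only [ef, eg]
  simp only [fx, gy, add_sub_cancel_right]
  have ef0 := ef 0
  have eg0 := eg 0
  simp only [fx, gy, add_sub_cancel_right, zero_sub, neg_sq] at ef0 eg0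
  rw [ef0, eg0]
  have ix := hxm.integrable le_top
  have iy := hym.integrable le_top
  have ixx := hxm.top_sq.integrable le_top
  have iyy := hym.top_sq.integrable le_top
  have ixy := (hxm.top_mul hym).integrable le_top
  have ixxyy := (hxm.top_mul hym).top_sq.integrable le_top
  set vx := ∫ z, x z ^ 2 ∂ν with hvx
  set vy := ∫ z, y z ^ 2 ∂ν with hvy
  set c := ∫ z, x z * y z ∂ν with hc
  have hvx0 : 0 ≤ vx := integral_nonneg fun z => sq_nonneg _
  have hvy0 : 0 ≤ vy := integral_nonneg fun z => sq_nonneg _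
  have hcs : c ^ 2 ≤ vx * vy := sq_integral_mul_le hxm hym
  have hT : ∫ z, (x z ^ 2 + vx) * (y z ^ 2 + vy) ∂ν
      = (∫ z, (x z * y z) ^ 2 ∂ν) + 3 * (vx * vy) := by
    calc _ = ∫ z, ((x z * y z) ^ 2 + vy * x z ^ 2 + vx * y z ^ 2 + vx * vy) ∂ν := by
          congr 1; ext z; ring
      _ = _ := by
          rw [integral_add ((ixxyy.fun_add (ixx.const_mul vy)).fun_add (iyy.const_mul vx))
              (integrable_const _),
            integral_add (ixxyy.fun_add (ixx.const_mul vy)) (iyy.const_mul vx),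
            integral_add ixxyy (ixx.const_mul vy), integral_const_mul, integral_const_mul,
            ← hvx, ← hvy]
          simp
          ring
  have hL : ∫ z, (s * t + s * y z + t * x z) ^ 2 ∂ν
      = s ^ 2 * t ^ 2 + s ^ 2 * vy + t ^ 2 * vx + 2 * s * t * c := by
    calc _ = ∫ z, (s ^ 2 * y z ^ 2 + t ^ 2 * x z ^ 2 + 2 * s * t * (x z * y z)
            + 2 * s ^ 2 * t * y z + 2 * s * t ^ 2 * x z + s ^ 2 * t ^ 2) ∂ν := by
          congr 1; ext z; ring
      _ = _ := by
          have i₁ := (iyy.const_mul (s ^ 2)).fun_add (ixx.const_mul (t ^ 2))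
          have i₂ := i₁.fun_add (ixy.const_mul (2 * s * t))
          have i₃ := i₂.fun_add (iy.const_mul (2 * s ^ 2 * t))
          have i₄ := i₃.fun_add (ix.const_mul (2 * s * t ^ 2))
          rw [integral_add i₄ (integrable_const _),
            integral_add i₃ (ix.const_mul (2 * s * t ^ 2)),
            integral_add i₂ (iy.const_mul (2 * s ^ 2 * t)),
            integral_add i₁ (ixy.const_mul (2 * s * t)),
            integral_add (iyy.const_mul (s ^ 2)) (ixx.const_mul (t ^ 2))]
          simp only [integral_const_mul, ex, ey, ← hvx, ← hvy, ← hc]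
          simp
          ring
  have mL : MemLp (fun z => s * t + s * y z + t * x z) ⊤ ν :=
    ((memLp_const (s * t)).add (hym.const_mul s)).add (hxm.const_mul t)
  have mR := hxm.top_mul hym
  have tri₁ := sqrt_integral_add_sq_le mL mR
  have tri₂ := sqrt_integral_add_sq_le (mL.add mR) mR.neg
  have eP : ∀ z, s * t + s * y z + t * x z + x z * y z = (x z + s) * (y z + t) :=
    fun z => by ring
  simp only [Pi.add_apply, Pi.neg_apply, add_neg_cancel_right, neg_sq] at tri₂
  simp only [eP, mul_pow (_ + _) (_ + _)] at tri₁ tri₂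
  rw [hT]
  rw [hL] at tri₁ tri₂
  have hR0 : 0 ≤ ∫ z, (x z * y z) ^ 2 ∂ν := integral_nonneg fun z => sq_nonneg _
  have hlq := abs_sqrt_sub_sqrt_mul_le hs0 ht0 hvx0 hvy0 hcs
  have hr := Real.sq_sqrt hR0
  have he := Real.sq_sqrt (mul_nonneg hvx0 hvy0)
  have hd : (√(∫ z, (x z + s) ^ 2 * (y z + t) ^ 2 ∂ν) - √((s ^ 2 + vx) * (t ^ 2 + vy))) ^ 2
      ≤ (√(∫ z, (x z * y z) ^ 2 ∂ν) + √(vx * vy)) ^ 2 := by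
    obtain ⟨h₁, h₂⟩ := abs_le.mp hlq
    exact sq_le_sq' (by linarith) (by linarith)
  linarith [sq_nonneg (√(∫ z, (x z * y z) ^ 2 ∂ν) - √(vx * vy)), mul_nonneg hvx0 hvy0]

end BoundedFunctions

/-- For measurable `a, b : 𝒵 → [0,1]` on a probability space `(𝒵, 𝒜, ν)`, letting
`P` be the mixture of products and `Q` the product of mixtures on `{0,1}×{0,1}`, the squared
Hellinger distance satisfies
`D_H²(P,Q) ≤ 6 ∫∫∫ D_H²(Ber(a z), Ber(a z')) · D_H²(Ber(b z), Ber(b z'')) dν dν dν`. -/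
theorem mixture_of_products_vs_product_of_mixtures_hellinger
    {Z : Type*} [MeasurableSpace Z] (ν : Measure Z) [IsProbabilityMeasure ν]
    (a b : Z → ℝ) (ha : Measurable a) (hb : Measurable b)
    (ha01 : ∀ z, a z ∈ Set.Icc (0 : ℝ) 1) (hb01 : ∀ z, b z ∈ Set.Icc (0 : ℝ) 1) :
    hellSq
      (fun xy : Fin 2 × Fin 2 =>
        ∫ z, (if xy.1 = 0 then a z else 1 - a z) * (if xy.2 = 0 then b z else 1 - b z) ∂ν)
      (fun xy : Fin 2 × Fin 2 =>
        (∫ z, (if xy.1 = 0 then a z else 1 - a z) ∂ν) *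
          ∫ z, (if xy.2 = 0 then b z else 1 - b z) ∂ν) ≤
      6 * ∫ z, (∫ z', (∫ z'',
          hellSq (ber (a z)) (ber (a z')) * hellSq (ber (b z)) (ber (b z'')) ∂ν) ∂ν) ∂ν := by
  have memLp_sqrt : ∀ h : Z → ℝ, Measurable h → (∀ z, h z ∈ Set.Icc (0 : ℝ) 1) →
      MemLp (fun z => √(h z)) ⊤ ν := fun h hm h01 =>
    memLp_top_of_bound hm.sqrt.aestronglyMeasurable 1 (.of_forall fun z => by
      rw [Real.norm_of_nonneg (Real.sqrt_nonneg _)]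
      exact Real.sqrt_le_one.mpr (h01 z).2)
  have ha01' : ∀ z, 1 - a z ∈ Set.Icc (0 : ℝ) 1 := fun z =>
    ⟨by linarith [(ha01 z).2], by linarith [(ha01 z).1]⟩
  have hb01' : ∀ z, 1 - b z ∈ Set.Icc (0 : ℝ) 1 := fun z =>
    ⟨by linarith [(hb01 z).2], by linarith [(hb01 z).1]⟩
  have ma := memLp_sqrt a ha ha01
  have mb := memLp_sqrt b hb hb01
  have ma' := memLp_sqrt (fun z => 1 - a z) (ha.const_sub 1) ha01'
  have mb' := memLp_sqrt (fun z => 1 - b z) (hb.const_sub 1) hb01'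
  have cell : ∀ f g : Z → ℝ, (∀ z, f z ∈ Set.Icc (0 : ℝ) 1) → (∀ z, g z ∈ Set.Icc (0 : ℝ) 1) →
      MemLp (fun z => √(f z)) ⊤ ν → MemLp (fun z => √(g z)) ⊤ ν →
      (√(∫ z, f z * g z ∂ν) - √((∫ z, f z ∂ν) * ∫ z, g z ∂ν)) ^ 2
        ≤ 2 * ∫ z, (∫ z', (√(f z) - √(f z')) ^ 2 ∂ν)
          * (∫ z'', (√(g z) - √(g z'')) ^ 2 ∂ν) ∂ν := by
    intro f g hf hg mf mg
    have := sq_sqrt_integral_sub_sqrt_le mf mg (fun z => Real.sqrt_nonneg _)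
      (fun z => Real.sqrt_nonneg _)
    simpa only [Real.sq_sqrt (hf _).1, Real.sq_sqrt (hg _).1] using this
  have mean : ∀ h : Z → ℝ, MemLp (fun z => √(h z)) ⊤ ν →
      MemLp (fun z => √(1 - h z)) ⊤ ν → ∀ z,
      ∫ z', hellSq (ber (h z)) (ber (h z')) ∂ν
        = 1 / 2 * ((∫ z', (√(h z) - √(h z')) ^ 2 ∂ν)
          + ∫ z', (√(1 - h z) - √(1 - h z')) ^ 2 ∂ν) := by
    intro h m m' z
    simp only [hellSq, ber, Fin.sum_univ_two, Matrix.cons_val_zero, Matrix.cons_val_one]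
    rw [integral_const_mul, integral_add]
    · exact ((memLp_const _).sub m).top_sq.integrable le_top
    · exact ((memLp_const _).sub m').top_sq.integrable le_top
  have mU : ∀ f : Z → ℝ, MemLp f ⊤ ν → MemLp (fun z => ∫ z', (f z - f z') ^ 2 ∂ν) ⊤ ν := by
    intro f mf
    simp only [integral_sub_sq_eq mf]
    exact (mf.sub (memLp_const _)).top_sq.add (memLp_const _)
  have c₁ := cell a b ha01 hb01 ma mb
  have c₂ := cell a (fun z => 1 - b z) ha01 hb01' ma mb'
  have c₃ := cell (fun z => 1 - a z) b ha01' hb01 ma' mb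
  have c₄ := cell (fun z => 1 - a z) (fun z => 1 - b z) ha01' hb01' ma' mb'
  have nonneg : ∀ f g : Z → ℝ, 0 ≤ ∫ z, (∫ z', (f z - f z') ^ 2 ∂ν)
      * (∫ z'', (g z - g z'') ^ 2 ∂ν) ∂ν := fun f g =>
    integral_nonneg fun z => mul_nonneg (integral_nonneg fun _ => sq_nonneg _)
      (integral_nonneg fun _ => sq_nonneg _)
  have n₁ := nonneg (fun z => √(a z)) (fun z => √(b z))
  have n₂ := nonneg (fun z => √(a z)) (fun z => √(1 - b z))
  have n₃ := nonneg (fun z => √(1 - a z)) (fun z => √(b z))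
  have n₄ := nonneg (fun z => √(1 - a z)) (fun z => √(1 - b z))
  simp only [integral_const_mul, integral_mul_const, mean a ma ma', mean b mb mb']
  replace ma := mU _ ma
  replace mb := mU _ mb
  replace ma' := mU _ ma'
  replace mb' := mU _ mb'
  set A := fun z => ∫ z', (√(a z) - √(a z')) ^ 2 ∂ν
  set A' := fun z => ∫ z', (√(1 - a z) - √(1 - a z')) ^ 2 ∂ν
  set B := fun z => ∫ z', (√(b z) - √(b z')) ^ 2 ∂ν
  set B' := fun z => ∫ z', (√(1 - b z) - √(1 - b z')) ^ 2 ∂ν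
  have split : ∫ z, 1 / 2 * (A z + A' z) * (1 / 2 * (B z + B' z)) ∂ν
      = 1 / 4 * ((∫ z, A z * B z ∂ν) + (∫ z, A z * B' z ∂ν)
        + (∫ z, A' z * B z ∂ν) + ∫ z, A' z * B' z ∂ν) := by
    have i₁ := (ma.top_mul mb).integrable le_top
    have i₂ := (ma.top_mul mb').integrable le_top
    have i₃ := (ma'.top_mul mb).integrable le_top
    have i₄ := (ma'.top_mul mb').integrable le_top
    rw [← integral_add i₁ i₂, ← integral_add (i₁.fun_add i₂) i₃,
      ← integral_add ((i₁.fun_add i₂).fun_add i₃) i₄, ← integral_const_mul]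
    refine integral_congr_ae (.of_forall fun z => ?_)
    ring
  refine le_of_le_of_eq ?_ (congrArg (6 * ·) split.symm)
  simp only [hellSq, Fintype.sum_prod_type, Fin.sum_univ_two, if_true, one_ne_zero, if_false]
  linarith
end
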